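/- arXiv:2406.17622 — 2 statements merged into one kernel-verified Lean document; each statement's English description precedes it below -/
import Mathlib

section
/- Let d ≥ 5 and let (ρ_x)_{x∈ℤ^d} be a family of [0,1)-valued random variables on a probability space, with sup_{x∈ℤ^d} E[(1−ρ_x)^{-1}] < ∞. Then E[∑_{x∈ℤ^d} π_ρ(x) g(0,x)²] < ∞, where g is the Green's function of the simple random walk on ℤ^d and π_ρ(x) = (1−ρ_x)^{-1}; consequently, almost surely ∑_{n≥1} n · p_ρ^n(0,0) < ∞, where p_ρ^n are the n-step probabilities of the trap walk with environment ρ. -/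
open MeasureTheory
open scoped ENNReal NNReal Classical

noncomputable section

/-- The lattice `ℤ^d`. -/
abbrev Zd (d : ℕ) := Fin d → ℤ

/-- Euclidean norm of a lattice point. -/
def znorm {d : ℕ} (x : Zd d) : ℝ := Real.sqrt (∑ i, ((x i : ℝ)) ^ 2)

/-- Matrix powers of a (sub-)stochastic kernel on `ℤ^d`, valued in `[0,∞]`. -/
def kpow {d : ℕ} (p : Zd d → Zd d → ℝ≥0∞) : ℕ → Zd d → Zd d → ℝ≥0∞
  | 0 => fun x y => if x = y then 1 else 0
  | n + 1 => fun x y => ∑' z : Zd d, kpow p n x z * p z y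

/-- Transition kernel of the trap walk with environment `ρ`. -/
def trapK {d : ℕ} (ρ : Zd d → ℝ) (x y : Zd d) : ℝ≥0∞ :=
  if x = y then ENNReal.ofReal (ρ x)
  else if znorm (x - y) = 1 then ENNReal.ofReal ((1 - ρ x) / (2 * d)) else 0

/-- Transition kernel of the simple random walk on `ℤ^d`. -/
def srwK (d : ℕ) (x y : Zd d) : ℝ≥0∞ :=
  if znorm (x - y) = 1 then (2 * (d : ℝ≥0∞))⁻¹ else 0

/-- Green's function of the simple random walk on `ℤ^d`. -/
def gSRW (d : ℕ) (x y : Zd d) : ℝ≥0∞ := ∑' n : ℕ, kpow (srwK d) n x y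

theorem kpow_add {d : ℕ} (p : Zd d → Zd d → ℝ≥0∞) (m n : ℕ) (x y : Zd d) :
    kpow p (m + n) x y = ∑' z, kpow p m x z * kpow p n z y := by
  induction n generalizing y with
  | zero => simp [kpow]
  | succ n ih =>
    rw [← add_assoc]
    simp only [kpow, ih, ← ENNReal.tsum_mul_left, ← ENNReal.tsum_mul_right]
    rw [ENNReal.tsum_comm]
    simp only [mul_assoc]

theorem kpow_one {d : ℕ} (p : Zd d → Zd d → ℝ≥0∞) (x y : Zd d) : kpow p 1 x y = p x y := by
  simp [kpow]

theorem kpow_symm {d : ℕ} {p : Zd d → Zd d → ℝ≥0∞} (hp : ∀ x y, p x y = p y x) (n : ℕ)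
    (x y : Zd d) : kpow p n x y = kpow p n y x := by
  induction n generalizing x y with
  | zero => simp [kpow, eq_comm]
  | succ n ih =>
    rw [add_comm, kpow_add, add_comm]
    simp only [kpow_one]
    rw [kpow]
    exact tsum_congr fun z => by rw [ih z y, hp x z, mul_comm]

/-- Green's function of a kernel. -/
def green {d : ℕ} (p : Zd d → Zd d → ℝ≥0∞) (x y : Zd d) : ℝ≥0∞ := ∑' n : ℕ, kpow p n x y

theorem green_symm {d : ℕ} {p : Zd d → Zd d → ℝ≥0∞} (hp : ∀ x y, p x y = p y x)
    (x y : Zd d) : green p x y = green p y x :=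
  tsum_congr fun n => kpow_symm hp n x y

theorem tsum_green_mul_green {d : ℕ} (p : Zd d → Zd d → ℝ≥0∞) (x : Zd d) :
    ∑' z, green p x z * green p z x = ∑' n : ℕ, ((n : ℝ≥0∞) + 1) * kpow p n x x := by
  calc ∑' z, green p x z * green p z x
      = ∑' z, ∑' m, ∑' n, kpow p m x z * kpow p n z x := by
        simp only [green, ← ENNReal.tsum_mul_left, ← ENNReal.tsum_mul_right]
        exact tsum_congr fun z => ENNReal.tsum_comm
    _ = ∑' m, ∑' n, kpow p (m + n) x x := by
        rw [ENNReal.tsum_comm]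
        refine tsum_congr fun m => ?_
        rw [ENNReal.tsum_comm]
        exact tsum_congr fun n => (kpow_add p m n x x).symm
    _ = ∑' q : ℕ × ℕ, kpow p (q.1 + q.2) x x :=
        (ENNReal.tsum_prod (f := fun m n => kpow p (m + n) x x)).symm
    _ = ∑' n : ℕ, ((n : ℝ≥0∞) + 1) * kpow p n x x := by
        rw [← Finset.HasAntidiagonal.sigmaAntidiagonalEquivProd.tsum_eq, ENNReal.tsum_sigma']
        refine tsum_congr fun n => ?_
        rw [tsum_fintype]
        calc _ = ∑ _q : Finset.HasAntidiagonal.antidiagonal n, kpow p n x x :=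
              Finset.sum_congr rfl fun q _ => by
                simp [Finset.HasAntidiagonal.sigmaAntidiagonalEquivProd, Finset.HasAntidiagonal.mem_antidiagonal.1 q.2]
          _ = _ := by simp

theorem green_eq_add {d : ℕ} (p : Zd d → Zd d → ℝ≥0∞) (x y : Zd d) :
    green p x y = (if x = y then 1 else 0) + ∑' z, green p x z * p z y := by
  rw [green, tsum_eq_zero_add' ENNReal.summable]
  simp only [green, ← ENNReal.tsum_mul_right]
  rw [ENNReal.tsum_comm]
  rfl

/-- The Green's function is the smallest solution of `h = 1 + h p`. -/
theorem green_le {d : ℕ} {p : Zd d → Zd d → ℝ≥0∞} {x : Zd d} {h : Zd d → ℝ≥0∞}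
    (hh : ∀ y, (if x = y then 1 else 0) + ∑' z, h z * p z y ≤ h y) (y : Zd d) :
    green p x y ≤ h y := by
  refine ENNReal.tsum_le_of_sum_range_le fun n => ?_
  induction n generalizing y with
  | zero => simp
  | succ n ih =>
    refine le_trans ?_ (hh y)
    rw [Finset.sum_range_succ', add_comm]
    refine add_le_add le_rfl ?_
    calc _ = ∑' z, (∑ k ∈ Finset.range n, kpow p k x z) * p z y := by
          simp only [kpow, Finset.sum_mul]
          exact (Summable.tsum_finsetSum fun _ _ => ENNReal.summable).symm
      _ ≤ _ := ENNReal.tsum_le_tsum fun z => by gcongr; exact ih z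

theorem znorm_sub_comm {d : ℕ} (x y : Zd d) : znorm (x - y) = znorm (y - x) := by
  unfold znorm
  congr 1
  refine Finset.sum_congr rfl fun i _ => ?_
  simp only [Pi.sub_apply]
  push_cast
  ring

theorem srwK_symm {d : ℕ} (x y : Zd d) : srwK d x y = srwK d y x := by
  simp only [srwK, znorm_sub_comm]

theorem mul_trapK {d : ℕ} {ρ : Zd d → ℝ} (hρ : ∀ x, ρ x ∈ Set.Ico (0 : ℝ) 1)
    (z y : Zd d) : ENNReal.ofReal ((1 - ρ z)⁻¹) * trapK ρ z y =
      srwK d z y + if z = y then ENNReal.ofReal ((1 - ρ z)⁻¹ * ρ z) else 0 := by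
  have h1 : 0 < 1 - ρ z := by linarith [(hρ z).2]
  by_cases hzy : z = y
  · subst hzy
    simp [trapK, srwK, znorm, ENNReal.ofReal_mul (inv_nonneg.2 h1.le)]
  · by_cases hn : znorm (z - y) = 1
    · have hd : d ≠ 0 := by
        rintro rfl
        simp [znorm] at hn
      have hd' : (0 : ℝ) < d := by positivity
      simp only [trapK, srwK, if_neg hzy, if_pos hn, add_zero]
      rw [← ENNReal.ofReal_mul (by positivity),
        show (1 - ρ z)⁻¹ * ((1 - ρ z) / (2 * d)) = (2 * (d : ℝ))⁻¹ by field_simp,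
        ENNReal.ofReal_inv_of_pos (by positivity), ENNReal.ofReal_mul (by norm_num)]
      simp
    · simp [trapK, srwK, hzy, hn]

theorem green_trapK_le {d : ℕ} {ρ : Zd d → ℝ} (hρ : ∀ x, ρ x ∈ Set.Ico (0 : ℝ) 1)
    (x y : Zd d) :
    green (trapK ρ) x y ≤ gSRW d x y * ENNReal.ofReal ((1 - ρ y)⁻¹) := by
  refine green_le (h := fun y => gSRW d x y * ENNReal.ofReal ((1 - ρ y)⁻¹)) (fun y => ?_) y
  have h1 : 0 < 1 - ρ y := by linarith [(hρ y).2]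
  have hg : gSRW d x y = (if x = y then 1 else 0) + ∑' z, gSRW d x z * srwK d z y :=
    green_eq_add (srwK d) x y
  have hπ : ENNReal.ofReal ((1 - ρ y)⁻¹) = 1 + ENNReal.ofReal ((1 - ρ y)⁻¹ * ρ y) := by
    rw [← ENNReal.ofReal_one, ← ENNReal.ofReal_add zero_le_one
      (mul_nonneg (inv_nonneg.2 h1.le) (hρ y).1)]
    congr 1
    field_simp
    ring
  simp only [mul_assoc, mul_trapK hρ, mul_add, ENNReal.tsum_add, mul_ite, mul_zero,
    tsum_ite_eq]
  rw [hπ, mul_add, mul_one, ← add_assoc, ← hg]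

/-- The uniform probability measure on `(0, 2π]`. -/
def angleMeasure : Measure ℝ :=
  ENNReal.ofReal (2 * Real.pi)⁻¹ • volume.restrict (Set.Ioc 0 (2 * Real.pi))

instance : IsProbabilityMeasure angleMeasure := ⟨by
  have := Real.two_pi_pos
  rw [angleMeasure, Measure.smul_apply, Measure.restrict_apply_univ, Real.volume_Ioc, sub_zero,
    smul_eq_mul, ← ENNReal.ofReal_mul (by positivity), inv_mul_cancel₀ this.ne',
    ENNReal.ofReal_one]⟩

theorem integral_angleMeasure {E : Type*} [NormedAddCommGroup E] [NormedSpace ℝ E] (f : ℝ → E) :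
    ∫ θ, f θ ∂angleMeasure = (2 * Real.pi)⁻¹ • ∫ θ in (0 : ℝ)..2 * Real.pi, f θ := by
  have := Real.two_pi_pos
  rw [angleMeasure, integral_smul_measure, intervalIntegral.integral_of_le this.le,
    ENNReal.toReal_ofReal (by positivity)]

theorem integral_angleMeasure_exp {k : ℤ} (hk : k ≠ 0) :
    ∫ θ, Complex.exp (k * Complex.I * (θ : ℝ)) ∂angleMeasure = 0 := by
  have hc : (k : ℂ) * Complex.I ≠ 0 := by simp [hk]
  rw [integral_angleMeasure, integral_exp_mul_complex hc]
  have : (k : ℂ) * Complex.I * ((2 * Real.pi : ℝ) : ℂ) = k * (2 * Real.pi * Complex.I) := by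
    push_cast
    ring
  rw [this, Complex.exp_int_mul_two_pi_mul_I]
  simp

theorem integral_angleMeasure_exp_neg_sin_sq {s : ℝ} (hs : 0 < s) :
    ∫ θ, Real.exp (-s * Real.sin θ ^ 2) ∂angleMeasure ≤ Real.pi / Real.sqrt s := by
  have hper : Function.Periodic (fun θ => Real.exp (-s * Real.sin θ ^ 2)) Real.pi := fun θ => by
    simp [Real.sin_add_pi]
  have hcont : Continuous fun θ => Real.exp (-s * Real.sin θ ^ 2) := by fun_prop
  have hpi := Real.pi_pos
  have hhalf : ∫ θ in -(Real.pi / 2)..Real.pi / 2, Real.exp (-s * Real.sin θ ^ 2) ≤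
      Real.pi * Real.pi / Real.sqrt s := by
    have hb : 0 < 4 * s / Real.pi ^ 2 := by positivity
    calc ∫ θ in -(Real.pi / 2)..Real.pi / 2, Real.exp (-s * Real.sin θ ^ 2)
        ≤ ∫ θ in -(Real.pi / 2)..Real.pi / 2, Real.exp (-(4 * s / Real.pi ^ 2) * θ ^ 2) := by
          refine intervalIntegral.integral_mono_on (by linarith) (hcont.intervalIntegrable _ _)
            (Continuous.intervalIntegrable (by fun_prop) _ _) fun θ hθ => ?_
          have h1 : 2 / Real.pi * |θ| ≤ |Real.sin θ| :=
            Real.mul_abs_le_abs_sin (abs_le.2 ⟨by linarith [hθ.1], hθ.2⟩)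
          have h2 : (2 / Real.pi * |θ|) ^ 2 ≤ Real.sin θ ^ 2 := by
            rw [← sq_abs (Real.sin θ)]
            gcongr
          have h3 : 4 * s / Real.pi ^ 2 * θ ^ 2 = s * (2 / Real.pi * |θ|) ^ 2 := by
            rw [mul_pow, sq_abs]
            ring
          refine Real.exp_le_exp.2 ?_
          nlinarith
      _ ≤ ∫ θ : ℝ, Real.exp (-(4 * s / Real.pi ^ 2) * θ ^ 2) := by
          rw [intervalIntegral.integral_of_le (by linarith)]
          exact setIntegral_le_integral (integrable_exp_neg_mul_sq hb)
            (Filter.Eventually.of_forall fun θ => (Real.exp_pos _).le)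
      _ = Real.sqrt (Real.pi / (4 * s / Real.pi ^ 2)) := integral_gaussian _
      _ ≤ Real.sqrt ((Real.pi * Real.pi) ^ 2 / s) := by
          refine Real.sqrt_le_sqrt ?_
          rw [div_div_eq_mul_div, div_le_div_iff₀ (by positivity) hs]
          have : Real.pi ^ 3 * s ≤ Real.pi ^ 4 * s * 4 := by
            have : Real.pi ^ 3 ≤ Real.pi ^ 4 * 4 := by
              nlinarith [pow_pos hpi 3, Real.pi_gt_three]
            nlinarith
          nlinarith
      _ = Real.pi * Real.pi / Real.sqrt s := by
          rw [Real.sqrt_div (by positivity), Real.sqrt_sq (by positivity)]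
  have hint : ∀ a b, IntervalIntegrable (fun θ => Real.exp (-s * Real.sin θ ^ 2)) volume a b :=
    fun a b => hcont.intervalIntegrable a b
  have h0 := hper.intervalIntegral_add_eq 0 (-(Real.pi / 2))
  have h1 := hper.intervalIntegral_add_eq Real.pi (-(Real.pi / 2))
  have e : -(Real.pi / 2) + Real.pi = Real.pi / 2 := by ring
  rw [e] at h0 h1
  rw [zero_add] at h0
  rw [← two_mul] at h1
  rw [integral_angleMeasure, ← intervalIntegral.integral_add_adjacent_intervals
    (hint 0 Real.pi) (hint Real.pi (2 * Real.pi)), h0, h1, smul_eq_mul]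
  calc _ ≤ (2 * Real.pi)⁻¹ * (Real.pi * Real.pi / Real.sqrt s + Real.pi * Real.pi / Real.sqrt s) := by
        gcongr
    _ = Real.pi / Real.sqrt s := by
        field_simp
        ring

/-- The characteristic function of one step of the simple random walk. -/
def stepChar (d : ℕ) (θ : Fin d → ℝ) : ℝ := (d : ℝ)⁻¹ * ∑ i, Real.cos (θ i)

/-- The Fourier integral that gives the `n`-step transition probabilities. -/
def stepFourier (d n : ℕ) (x : Zd d) : ℝ :=
  ∫ θ, stepChar d θ ^ n * Real.cos (∑ i, (x i : ℝ) * θ i) ∂(Measure.pi fun _ => angleMeasure)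

theorem abs_stepChar_le {d : ℕ} (θ : Fin d → ℝ) : |stepChar d θ| ≤ 1 := by
  rcases Nat.eq_zero_or_pos d with rfl | hd
  · simp [stepChar]
  · have hd' : (0 : ℝ) < d := by positivity
    rw [stepChar, abs_mul, abs_of_pos (inv_pos.2 hd'), inv_mul_le_iff₀ hd', mul_one]
    calc _ ≤ ∑ i, |Real.cos (θ i)| := Finset.abs_sum_le_sum_abs _ _
      _ ≤ ∑ _i : Fin d, (1 : ℝ) := Finset.sum_le_sum fun i _ => Real.abs_cos_le_one _
      _ = d := by simp

theorem continuous_stepChar (d : ℕ) : Continuous (stepChar d) := by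
  unfold stepChar
  fun_prop

theorem integrable_stepFourier (d n : ℕ) (x : Zd d) :
    Integrable (fun θ => stepChar d θ ^ n * Real.cos (∑ i, (x i : ℝ) * θ i))
      (Measure.pi fun _ => angleMeasure) := by
  have := continuous_stepChar d
  refine Integrable.of_bound (Continuous.aestronglyMeasurable (by fun_prop)) 1
    (Filter.Eventually.of_forall fun θ => ?_)
  rw [Real.norm_eq_abs, abs_mul, abs_pow]
  exact mul_le_one₀ (pow_le_one₀ (abs_nonneg _) (abs_stepChar_le θ)) (abs_nonneg _)
    (Real.abs_cos_le_one _)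

theorem stepFourier_zero (d : ℕ) (x : Zd d) :
    stepFourier d 0 x = if 0 = x then 1 else 0 := by
  simp only [stepFourier, pow_zero, one_mul]
  split_ifs with hx
  · subst hx
    simp
  · obtain ⟨j, hj⟩ := Function.ne_iff.1 (Ne.symm hx)
    have h1 : ∀ θ : Fin d → ℝ, Real.cos (∑ i, (x i : ℝ) * θ i) =
        RCLike.re (∏ i, Complex.exp (x i * Complex.I * (θ i : ℝ))) := fun θ => by
      rw [← Complex.exp_sum, ← Complex.exp_ofReal_mul_I_re]
      simp only [RCLike.re_eq_complex_re]
      congr 2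
      push_cast
      rw [Finset.sum_mul]
      exact Finset.sum_congr rfl fun i _ => by ring
    simp only [h1]
    rw [integral_re, integral_fintype_prod_eq_prod
      (f := fun i (t : ℝ) => Complex.exp (x i * Complex.I * (t : ℂ))),
      Finset.prod_eq_zero (Finset.mem_univ j) (integral_angleMeasure_exp hj), map_zero]
    refine Integrable.of_bound (Continuous.aestronglyMeasurable (by fun_prop)) 1
      (Filter.Eventually.of_forall fun θ => ?_)
    rw [norm_prod]
    refine Finset.prod_le_one (fun _ _ => norm_nonneg _) fun i _ => ?_
    rw [Complex.norm_exp]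
    simp

theorem sum_add_single_mul {d : ℕ} (x : Zd d) (θ : Fin d → ℝ) (i : Fin d) (c : ℤ) :
    ∑ j, ((x + Pi.single i c : Zd d) j : ℝ) * θ j = ∑ j, (x j : ℝ) * θ j + c * θ i := by
  simp only [Pi.add_apply, Int.cast_add, add_mul, Finset.sum_add_distrib]
  congr 1
  rw [Finset.sum_eq_single i]
  · simp
  · intro j _ hj
    simp [hj]
  · simp

theorem stepFourier_succ (d n : ℕ) (x : Zd d) :
    stepFourier d (n + 1) x = ∑ i, (2 * (d : ℝ))⁻¹ *
      (stepFourier d n (x + Pi.single i 1) + stepFourier d n (x + Pi.single i (-1))) := by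
  have hI := integrable_stepFourier d n
  simp only [stepFourier]
  simp only [← integral_add (hI _) (hI _), ← integral_const_mul]
  rw [← integral_finsetSum _ fun i _ => Integrable.const_mul (Integrable.fun_add (hI _) (hI _)) _]
  refine integral_congr_ae (Filter.Eventually.of_forall fun θ => ?_)
  simp only [sum_add_single_mul]
  calc stepChar d θ ^ (n + 1) * Real.cos (∑ i, (x i : ℝ) * θ i)
      = stepChar d θ ^ n * Real.cos (∑ i, (x i : ℝ) * θ i) * stepChar d θ := by ring
    _ = _ := by
      conv_lhs => arg 2; rw [stepChar]
      rw [← mul_assoc, Finset.mul_sum]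
      refine Finset.sum_congr rfl fun i _ => ?_
      rw [Real.cos_add, Real.cos_add]
      push_cast
      rw [one_mul, neg_one_mul, Real.cos_neg, Real.sin_neg, mul_inv]
      ring

theorem exists_eq_single_of_znorm {d : ℕ} {w : Zd d} (hw : znorm w = 1) :
    ∃ i, w = Pi.single i 1 ∨ w = Pi.single i (-1) := by
  have h1 : ∑ i, w i ^ 2 = 1 := by
    rw [znorm, Real.sqrt_eq_one] at hw
    exact_mod_cast hw
  obtain ⟨i, hi⟩ : ∃ i, w i ≠ 0 := by
    by_contra! h
    simp [h] at h1
  have h2 := Finset.add_sum_erase Finset.univ (fun j => w j ^ 2) (Finset.mem_univ i)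
  have h3 : 0 ≤ ∑ j ∈ Finset.univ.erase i, w j ^ 2 := Finset.sum_nonneg fun _ _ => sq_nonneg _
  have h4 : 0 < w i ^ 2 := by positivity
  have h5 : ∑ j ∈ Finset.univ.erase i, w j ^ 2 = 0 := by omega
  have h6 : w i ^ 2 = 1 := by omega
  have h7 : ∀ j, j ≠ i → w j = 0 := fun j hj => by
    have := (Finset.sum_eq_zero_iff_of_nonneg fun _ _ => sq_nonneg _).1 h5 j (by simp [hj])
    simpa using this
  have h8 : ∀ c, w i = c → w = Pi.single i c := fun c hc => by
    ext j
    by_cases hj : j = i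
    · subst hj
      simp [hc]
    · simp [hj, h7 j hj]
  exact ⟨i, (sq_eq_one_iff.1 h6).imp (h8 _) (h8 _)⟩

theorem srwK_le_sum {d : ℕ} (z x : Zd d) :
    srwK d z x ≤ ∑ i, (2 * (d : ℝ≥0∞))⁻¹ *
      ((if z = x + Pi.single i 1 then 1 else 0) + if z = x + Pi.single i (-1) then 1 else 0) := by
  unfold srwK
  split_ifs with h
  · obtain ⟨i, hi⟩ := exists_eq_single_of_znorm h
    simp only [sub_eq_iff_eq_add'] at hi
    refine le_trans ?_ (Finset.single_le_sum (fun _ _ => zero_le) (Finset.mem_univ i))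
    rcases hi with hi | hi
    · simp only [if_pos hi, mul_add, mul_one]
      exact le_self_add
    · simp only [if_pos hi, mul_add, mul_one]
      exact le_add_self
  · exact zero_le

theorem stepFourier_nonneg (d n : ℕ) (x : Zd d) : 0 ≤ stepFourier d n x := by
  induction n generalizing x with
  | zero =>
    rw [stepFourier_zero]
    split_ifs <;> norm_num
  | succ n ih =>
    rw [stepFourier_succ]
    exact Finset.sum_nonneg fun i _ => mul_nonneg (by positivity) (add_nonneg (ih _) (ih _))

theorem kpow_srwK_le {d : ℕ} (hd : 0 < d) (n : ℕ) (x : Zd d) :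
    kpow (srwK d) n 0 x ≤ ENNReal.ofReal (stepFourier d n x) := by
  induction n generalizing x with
  | zero =>
    rw [stepFourier_zero]
    simp only [kpow]
    split_ifs <;> simp
  | succ n ih =>
    have hd' : (0 : ℝ) < d := by positivity
    have hnn := stepFourier_nonneg d n
    calc kpow (srwK d) (n + 1) 0 x
        ≤ ∑' z, ∑ i, (2 * (d : ℝ≥0∞))⁻¹ *
          ((if z = x + Pi.single i 1 then kpow (srwK d) n 0 z else 0) +
            if z = x + Pi.single i (-1) then kpow (srwK d) n 0 z else 0) := by
          refine ENNReal.tsum_le_tsum fun z => ?_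
          refine (mul_le_mul_right (srwK_le_sum z x) _).trans_eq ?_
          rw [Finset.mul_sum]
          refine Finset.sum_congr rfl fun i _ => ?_
          rw [mul_left_comm, mul_add]
          simp only [mul_ite, mul_one, mul_zero]
      _ = ∑ i, (2 * (d : ℝ≥0∞))⁻¹ *
          (kpow (srwK d) n 0 (x + Pi.single i 1) + kpow (srwK d) n 0 (x + Pi.single i (-1))) := by
          rw [Summable.tsum_finsetSum fun _ _ => ENNReal.summable]
          simp only [ENNReal.tsum_mul_left, ENNReal.tsum_add, tsum_ite_eq]
      _ ≤ ∑ i, ENNReal.ofReal ((2 * (d : ℝ))⁻¹ *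
          (stepFourier d n (x + Pi.single i 1) + stepFourier d n (x + Pi.single i (-1)))) := by
          refine Finset.sum_le_sum fun i _ => ?_
          rw [ENNReal.ofReal_mul (by positivity), ENNReal.ofReal_add (hnn _) (hnn _),
            ENNReal.ofReal_inv_of_pos (by positivity), ENNReal.ofReal_mul (by norm_num),
            ENNReal.ofReal_ofNat, ENNReal.ofReal_natCast]
          gcongr <;> exact ih _
      _ = ENNReal.ofReal (stepFourier d (n + 1) x) := by
          rw [stepFourier_succ, ENNReal.ofReal_sum_of_nonneg fun i _ =>
            mul_nonneg (by positivity) (add_nonneg (hnn _) (hnn _))]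

theorem abs_stepChar_pow_le {d : ℕ} (hd : 0 < d) (n : ℕ) (θ : Fin d → ℝ) :
    |stepChar d θ| ^ n ≤ ∏ i, Real.exp (-(n / (2 * d)) * Real.sin (θ i) ^ 2) := by
  have hd' : (0 : ℝ) < d := by positivity
  have h1 : |stepChar d θ| ≤ Real.exp (-∑ i, (2 * (d : ℝ))⁻¹ * Real.sin (θ i) ^ 2) := by
    refine le_trans ?_ (Real.add_one_le_exp _)
    calc |stepChar d θ| ≤ (d : ℝ)⁻¹ * ∑ i, |Real.cos (θ i)| := by
          rw [stepChar, abs_mul, abs_of_pos (inv_pos.2 hd')]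
          gcongr
          exact Finset.abs_sum_le_sum_abs _ _
      _ ≤ (d : ℝ)⁻¹ * ∑ i, (1 - 2⁻¹ * Real.sin (θ i) ^ 2) := by
          gcongr with i
          have := Real.sin_sq_add_cos_sq (θ i)
          nlinarith [sq_nonneg (1 - |Real.cos (θ i)|), sq_abs (Real.cos (θ i))]
      _ = _ := by
          rw [Finset.sum_sub_distrib, ← Finset.mul_sum, ← Finset.mul_sum]
          simp
          field_simp
          ring
  calc |stepChar d θ| ^ n ≤ Real.exp (-∑ i, (2 * (d : ℝ))⁻¹ * Real.sin (θ i) ^ 2) ^ n := by gcongr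
    _ = _ := by
      rw [← Real.exp_nat_mul, ← Real.exp_sum, ← Finset.sum_neg_distrib, Finset.mul_sum]
      congr 1
      refine Finset.sum_congr rfl fun i _ => ?_
      field_simp

theorem stepFourier_le {d : ℕ} (hd : 0 < d) {n : ℕ} (hn : 0 < n) (x : Zd d) :
    stepFourier d n x ≤ (Real.pi / Real.sqrt (n / (2 * d))) ^ d := by
  have hs : (0 : ℝ) < n / (2 * d) := by positivity
  calc stepFourier d n x
      ≤ ∫ θ : Fin d → ℝ, ∏ i, Real.exp (-(n / (2 * d)) * Real.sin (θ i) ^ 2)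
          ∂(Measure.pi fun _ => angleMeasure) := by
        refine integral_mono (integrable_stepFourier d n x) ?_ fun θ => ?_
        · refine Integrable.of_bound (Continuous.aestronglyMeasurable (by fun_prop)) 1
            (Filter.Eventually.of_forall fun θ => ?_)
          rw [norm_prod]
          refine Finset.prod_le_one (fun _ _ => norm_nonneg _) fun i _ => ?_
          rw [Real.norm_eq_abs, Real.abs_exp, Real.exp_le_one_iff]
          nlinarith [sq_nonneg (Real.sin (θ i))]
        · refine le_trans (le_abs_self _) ?_
          rw [abs_mul, abs_pow]
          exact (mul_le_of_le_one_right (by positivity) (Real.abs_cos_le_one _)).trans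
            (abs_stepChar_pow_le hd n θ)
    _ = ∏ _i : Fin d, ∫ t, Real.exp (-(n / (2 * d)) * Real.sin t ^ 2) ∂angleMeasure :=
        integral_fintype_prod_eq_prod
          (f := fun (_ : Fin d) (t : ℝ) => Real.exp (-(n / (2 * d)) * Real.sin t ^ 2))
    _ ≤ _ := by
        rw [Finset.prod_const, Finset.card_univ, Fintype.card_fin]
        exact pow_le_pow_left₀ (integral_nonneg fun _ => (Real.exp_pos _).le)
          (integral_angleMeasure_exp_neg_sin_sq hs) _

theorem tsum_succ_mul_kpow_srwK_lt_top {d : ℕ} (hd : 5 ≤ d) :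
    ∑' n : ℕ, ((n : ℝ≥0∞) + 1) * kpow (srwK d) n 0 0 < ∞ := by
  have hd0 : 0 < d := by omega
  have hd' : (0 : ℝ) < d := by positivity
  set C : ℝ := (Real.pi * Real.sqrt (2 * d)) ^ d
  have hC : 0 ≤ C := by positivity
  have key : ∀ n : ℕ, ((n : ℝ≥0∞) + 1) * kpow (srwK d) n 0 0 ≤
      ENNReal.ofReal ((if n = 0 then 1 else 0) + 2 * C * ((n : ℝ) ^ (3 / 2 : ℝ))⁻¹) := by
    intro n
    rcases Nat.eq_zero_or_pos n with rfl | hn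
    · simp [kpow, Real.zero_rpow]
    · have hn' : (1 : ℝ) ≤ n := by exact_mod_cast hn
      have hn0 : (0 : ℝ) < n := by linarith
      have hb : stepFourier d n 0 ≤ C * ((n : ℝ) ^ (5 / 2 : ℝ))⁻¹ := by
        refine (stepFourier_le hd0 hn 0).trans ?_
        rw [Real.sqrt_div' _ (by positivity), div_div_eq_mul_div, div_pow, div_eq_mul_inv]
        refine mul_le_mul_of_nonneg_left (inv_anti₀ (by positivity) ?_) hC
        rw [Real.sqrt_eq_rpow, ← Real.rpow_mul_natCast hn0.le]
        refine Real.rpow_le_rpow_of_exponent_le hn' ?_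
        have : (5 : ℝ) ≤ d := by exact_mod_cast hd
        linarith
      rw [if_neg hn.ne', zero_add]
      calc ((n : ℝ≥0∞) + 1) * kpow (srwK d) n 0 0
          ≤ ENNReal.ofReal (n + 1) * ENNReal.ofReal (C * ((n : ℝ) ^ (5 / 2 : ℝ))⁻¹) := by
            rw [ENNReal.ofReal_add hn0.le zero_le_one, ENNReal.ofReal_natCast,
              ENNReal.ofReal_one]
            gcongr
            exact (kpow_srwK_le hd0 n 0).trans (ENNReal.ofReal_le_ofReal hb)
        _ ≤ _ := by
            rw [← ENNReal.ofReal_mul (by positivity)]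
            refine ENNReal.ofReal_le_ofReal ?_
            have e : (n : ℝ) ^ (5 / 2 : ℝ) = n ^ (3 / 2 : ℝ) * n := by
              rw [← Real.rpow_add_one hn0.ne']
              norm_num
            rw [e, mul_inv]
            calc _ ≤ (2 * (n : ℝ)) * (C * (((n : ℝ) ^ (3 / 2 : ℝ))⁻¹ * (n : ℝ)⁻¹)) := by
                  gcongr
                  linarith
              _ = _ := by field_simp
  refine (ENNReal.tsum_le_tsum key).trans_lt (Summable.tsum_ofReal_lt_top ?_)
  refine Summable.add ?_ ((Real.summable_nat_rpow_inv.2 (by norm_num)).mul_left _)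
  exact summable_of_hasFiniteSupport ((Set.finite_singleton 0).subset fun n hn => by
    by_contra h
    simp_all)

theorem tsum_gSRW_sq_lt_top {d : ℕ} (hd : 5 ≤ d) : ∑' x, gSRW d 0 x ^ 2 < ∞ := by
  refine lt_of_eq_of_lt ?_ (tsum_succ_mul_kpow_srwK_lt_top hd)
  rw [← tsum_green_mul_green]
  refine tsum_congr fun x => ?_
  rw [green_symm srwK_symm x 0, sq]
  rfl

theorem stmt7 (d : ℕ) (hd : 5 ≤ d) {Ω : Type*} [MeasurableSpace Ω] (P : Measure Ω)
    [IsProbabilityMeasure P] (ρ : Ω → Zd d → ℝ)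
    (hmeas : ∀ x : Zd d, Measurable fun ω => ρ ω x)
    (hrange : ∀ ω x, ρ ω x ∈ Set.Ico (0 : ℝ) 1)
    (hsup : ∃ C : ℝ≥0∞, C < ∞ ∧ ∀ x : Zd d,
      ∫⁻ ω, ENNReal.ofReal ((1 - ρ ω x)⁻¹) ∂P ≤ C) :
    (∫⁻ ω, ∑' x : Zd d, ENNReal.ofReal ((1 - ρ ω x)⁻¹) * gSRW d 0 x ^ 2 ∂P < ∞) ∧
      ∀ᵐ ω ∂P, ∑' n : ℕ, (n : ℝ≥0∞) * kpow (trapK (ρ ω)) n 0 0 < ∞ := by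
  obtain ⟨C, hC, hle⟩ := hsup
  have hπ : ∀ x, Measurable fun ω => ENNReal.ofReal ((1 - ρ ω x)⁻¹) := fun x =>
    (measurable_const.sub (hmeas x)).inv.ennreal_ofReal
  have hterm : ∀ x, Measurable fun ω => ENNReal.ofReal ((1 - ρ ω x)⁻¹) * gSRW d 0 x ^ 2 :=
    fun x => (hπ x).mul_const _
  have hfin : ∫⁻ ω, ∑' x : Zd d, ENNReal.ofReal ((1 - ρ ω x)⁻¹) * gSRW d 0 x ^ 2 ∂P < ∞ := by
    rw [lintegral_tsum fun x => (hterm x).aemeasurable]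
    calc _ ≤ ∑' x, C * gSRW d 0 x ^ 2 := ENNReal.tsum_le_tsum fun x => by
          rw [lintegral_mul_const _ (hπ x)]
          gcongr
          exact hle x
      _ < ∞ := by
          rw [ENNReal.tsum_mul_left]
          exact ENNReal.mul_lt_top hC (tsum_gSRW_sq_lt_top hd)
  refine ⟨hfin, ?_⟩
  filter_upwards [ae_lt_top (Measurable.tsum hterm) hfin.ne] with ω hω
  calc ∑' n : ℕ, (n : ℝ≥0∞) * kpow (trapK (ρ ω)) n 0 0
      ≤ ∑' n : ℕ, ((n : ℝ≥0∞) + 1) * kpow (trapK (ρ ω)) n 0 0 :=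
        ENNReal.tsum_le_tsum fun n => by
          gcongr
          exact le_self_add
    _ = ∑' x, green (trapK (ρ ω)) 0 x * green (trapK (ρ ω)) x 0 :=
        (tsum_green_mul_green _ 0).symm
    _ ≤ ∑' x, ENNReal.ofReal ((1 - ρ ω 0)⁻¹) *
          (ENNReal.ofReal ((1 - ρ ω x)⁻¹) * gSRW d 0 x ^ 2) :=
        ENNReal.tsum_le_tsum fun x => by
          refine (mul_le_mul' (green_trapK_le (hrange ω) 0 x)
            (green_trapK_le (hrange ω) x 0)).trans_eq ?_
          rw [show gSRW d x 0 = gSRW d 0 x from green_symm srwK_symm x 0]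
          ring
    _ < ∞ := by
        rw [ENNReal.tsum_mul_left]
        exact ENNReal.mul_lt_top ENNReal.ofReal_lt_top hω
end
end

section
/- Let d ∈ {3,4} and let P be the law of a random traps environment ρ = (ρ_x)_{x∈ℤ^d} which is stationary under the shifts of ℤ^d and satisfies E[π_ρ(0)] < ∞, where π_ρ(x) = (1−ρ_x)^{-1}. For R > 0 set A^R_ρ = {x ∈ ℤ^d : π_ρ(x) ≥ R·max(|x|,1)²}. Then there exist R > 0, c > 0 and an integer K ≥ 1 such that for all n ≥ 2: E[ ∑_{x∈Λ_{Kn}} π_ρ(x) · (g̃^{Kn}_R(0,x))² ] ≥ c·n if d = 3, and ≥ c·log n if d = 4, where g̃^{Kn}_R denotes the Green's function of the trap walk killed upon exiting Λ_{Kn} or entering A^R_ρ (the killed Green's function with B = Λ_{Kn} ∖ A^R_ρ). -/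
open MeasureTheory
open scoped ENNReal NNReal Classical

noncomputable section

/-- Kernel killed outside the set `B`. -/
def kill {d : ℕ} (p : Zd d → Zd d → ℝ≥0∞) (B : Set (Zd d)) (x y : Zd d) : ℝ≥0∞ :=
  if x ∈ B ∧ y ∈ B then p x y else 0

/-- The box `Λ_m = ℤ^d ∩ [-m,m]^d`. -/
def lamF (d m : ℕ) : Finset (Zd d) := Fintype.piFinset fun _ => Finset.Icc (-(m : ℤ)) (m : ℤ)

/-- `π_ρ(x) = (1-ρ_x)⁻¹`, as an extended real. -/
def piT {d : ℕ} (ρ : Zd d → ℝ) (x : Zd d) : ℝ≥0∞ := ENNReal.ofReal ((1 - ρ x)⁻¹)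

/-- The set `A^R_ρ = {x : π_ρ(x) ≥ R·max(|x|,1)²}` of deep traps. -/
def Atrap {d : ℕ} (R : ℝ) (ρ : Zd d → ℝ) : Set (Zd d) :=
  {x | R * max (znorm x) 1 ^ 2 ≤ (1 - ρ x)⁻¹}

/-- Green's function of the trap walk killed upon exiting `Λ_m` or entering `A^R_ρ`. -/
def gKillTrap {d : ℕ} (ρ : Zd d → ℝ) (R : ℝ) (m : ℕ) (x y : Zd d) : ℝ≥0∞ :=
  ∑' k : ℕ, kpow (kill (trapK ρ) ((lamF d m : Set (Zd d)) \ Atrap R ρ)) k x y / piT ρ y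

/-- The neighbour of `x` in direction `p`. -/
def nbr {d : ℕ} (x : Zd d) (p : Fin d × Bool) : Zd d :=
  x + Pi.single p.1 (if p.2 then 1 else -1)

/-- The average of `f` over the neighbours of `x`. -/
def nbrAvg {d : ℕ} (f : Zd d → ℝ) (x : Zd d) : ℝ := (∑ p, f (nbr x p)) / (2 * d)

/-- The transition kernel of simple random walk. -/
def srw {d : ℕ} (x y : Zd d) : ℝ := if znorm (x - y) = 1 then 1 / (2 * d) else 0

theorem znorm_sq {d : ℕ} (x : Zd d) : znorm x ^ 2 = ∑ i, (x i : ℝ) ^ 2 :=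
  Real.sq_sqrt (Finset.sum_nonneg fun _ _ => sq_nonneg _)

theorem znorm_zero {d : ℕ} : znorm (0 : Zd d) = 0 := by simp [znorm]

theorem sq_le_znorm_sq {d : ℕ} (x : Zd d) (i : Fin d) : (x i : ℝ) ^ 2 ≤ znorm x ^ 2 := by
  rw [znorm_sq]
  exact Finset.single_le_sum (f := fun i => (x i : ℝ) ^ 2) (fun _ _ => sq_nonneg _)
    (Finset.mem_univ i)

theorem znorm_eq_one_iff {d : ℕ} (v : Zd d) :
    znorm v = 1 ↔ ∃ p : Fin d × Bool, v = Pi.single p.1 (if p.2 then 1 else -1) := by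
  constructor
  · intro h
    have h1 : ∑ i, (v i : ℝ) ^ 2 = 1 := by rw [← znorm_sq, h]; norm_num
    have h2 : ∑ i, (v i) ^ 2 = 1 := by exact_mod_cast h1
    have hne : ∃ i, v i ≠ 0 := by
      by_contra! hcon
      simp [hcon] at h2
    obtain ⟨i, hi⟩ := hne
    have hsplit := Finset.add_sum_erase Finset.univ (fun i => (v i) ^ 2) (Finset.mem_univ i)
    have hpos : 0 < (v i) ^ 2 := by positivity
    have hrest : 0 ≤ ∑ j ∈ Finset.univ.erase i, (v j) ^ 2 :=
      Finset.sum_nonneg fun _ _ => sq_nonneg _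
    have hz : ∑ j ∈ Finset.univ.erase i, (v j) ^ 2 = 0 := by
      omega
    have hone : (v i) ^ 2 = 1 := by
      omega
    have hother : ∀ j, j ≠ i → v j = 0 := by
      intro j hj
      have := (Finset.sum_eq_zero_iff_of_nonneg (fun _ _ => sq_nonneg _)).1 hz j
        (Finset.mem_erase.2 ⟨hj, Finset.mem_univ j⟩)
      exact pow_eq_zero_iff (two_ne_zero) |>.1 this
    have key : ∀ b : Bool, v i = (if b then 1 else -1) → ∃ p : Fin d × Bool,
        v = Pi.single p.1 (if p.2 then 1 else -1) := by
      intro b hb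
      refine ⟨(i, b), funext fun j => ?_⟩
      by_cases hj : j = i
      · subst hj
        simp [hb]
      · simp [hj, hother j hj]
    rcases (by simpa using hone : v i = 1 ∨ v i = -1) with h | h
    · exact key true (by simp [h])
    · exact key false (by simp [h])
  · rintro ⟨⟨i, b⟩, rfl⟩
    have : znorm (Pi.single i (if b then 1 else -1) : Zd d) ^ 2 = 1 := by
      rw [znorm_sq, Finset.sum_eq_single i]
      · cases b <;> simp
      · intro j _ hj
        simp [hj]
      · simp
    have hnn : 0 ≤ znorm (Pi.single i (if b then 1 else -1) : Zd d) := Real.sqrt_nonneg _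
    exact (pow_eq_one_iff_of_nonneg hnn two_ne_zero).1 this

theorem nbr_injective {d : ℕ} (x : Zd d) : Function.Injective (nbr x) := by
  rintro ⟨i, b⟩ ⟨j, b'⟩ h
  simp only [nbr, add_right_inj] at h
  have hij : i = j := by
    by_contra hij
    have := congrFun h i
    simp only [Pi.single_eq_same, Pi.single_eq_of_ne hij] at this
    cases b <;> simp at this
  subst hij
  have := congrFun h i
  simp only [Pi.single_eq_same] at this
  cases b <;> cases b' <;> simp_all

theorem znorm_sub_eq_one_iff {d : ℕ} (x y : Zd d) : znorm (x - y) = 1 ↔ ∃ p, nbr x p = y := by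
  rw [znorm_sub_comm, znorm_eq_one_iff]
  exact exists_congr fun p => by rw [nbr, sub_eq_iff_eq_add', eq_comm]

theorem srw_comm {d : ℕ} (x y : Zd d) : srw x y = srw y x := by
  simp only [srw, znorm_sub_comm x y]

theorem srw_nonneg {d : ℕ} (x y : Zd d) : 0 ≤ srw x y := by
  unfold srw
  split_ifs <;> positivity

theorem srw_self {d : ℕ} (x : Zd d) : srw x x = 0 := by
  simp [srw, znorm_zero]

theorem sum_srw_mul {d : ℕ} (D : Finset (Zd d)) (x : Zd d) (hD : ∀ p, nbr x p ∈ D)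
    (f : Zd d → ℝ) : ∑ y ∈ D, srw x y * f y = nbrAvg f x := by
  have himg : D.filter (fun y => znorm (x - y) = 1) = Finset.univ.image (nbr x) := by
    ext y
    simp only [Finset.mem_filter, znorm_sub_eq_one_iff, Finset.mem_image, Finset.mem_univ,
      true_and, and_iff_right_iff_imp]
    rintro ⟨p, rfl⟩
    exact hD p
  simp only [srw, ite_mul, zero_mul]
  rw [← Finset.sum_filter, himg, Finset.sum_image fun p _ q _ h => nbr_injective x h, nbrAvg,
    Finset.sum_div]
  exact Finset.sum_congr rfl fun _ _ => by ring

theorem sum_srw_mul_le {d : ℕ} (B : Finset (Zd d)) (x : Zd d) (f : Zd d → ℝ) (hf : ∀ y, 0 ≤ f y) :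
    ∑ y ∈ B, srw x y * f y ≤ nbrAvg f x := by
  rw [← sum_srw_mul (B ∪ Finset.univ.image (nbr x)) x
    (fun p => Finset.mem_union_right _ (Finset.mem_image_of_mem _ (Finset.mem_univ p)))]
  exact Finset.sum_le_sum_of_subset_of_nonneg Finset.subset_union_left
    fun y _ _ => mul_nonneg (srw_nonneg x y) (hf y)

theorem mem_lamF {d m : ℕ} (x : Zd d) : x ∈ lamF d m ↔ ∀ i, |x i| ≤ m := by
  simp only [lamF, Fintype.mem_piFinset, Finset.mem_Icc, abs_le]

theorem card_lamF (d m : ℕ) : (lamF d m).card = (2 * m + 1) ^ d := by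
  simp only [lamF, Fintype.card_piFinset_const, Int.card_Icc]
  congr 1
  omega

theorem lamF_mono (d : ℕ) {m n : ℕ} (h : m ≤ n) : lamF d m ⊆ lamF d n := by
  intro x hx
  rw [mem_lamF] at hx ⊢
  exact fun i => (hx i).trans (by exact_mod_cast h)

theorem nbr_mem_lamF {d m : ℕ} {x : Zd d} (hx : x ∈ lamF d m) (p : Fin d × Bool) :
    nbr x p ∈ lamF d (m + 1) := by
  rw [mem_lamF] at hx ⊢
  intro i
  have h1 := hx i
  have h2 : |(Pi.single p.1 (if p.2 then 1 else -1) : Zd d) i| ≤ 1 := by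
    by_cases hi : i = p.1
    · subst hi
      cases p.2 <;> simp
    · simp [hi]
  simp only [nbr, Pi.add_apply]
  push_cast
  exact (abs_add_le _ _).trans (add_le_add h1 h2)

theorem natCast_succ_sq_le_znorm_sq {d m : ℕ} {x : Zd d} (hx : x ∉ lamF d m) :
    ((m : ℝ) + 1) ^ 2 ≤ znorm x ^ 2 := by
  simp only [mem_lamF, not_forall, not_le] at hx
  obtain ⟨i, hi⟩ := hx
  refine le_trans ?_ (sq_le_znorm_sq x i)
  have h : (m : ℤ) + 1 ≤ |x i| := hi
  have h' : (m : ℝ) + 1 ≤ |(x i : ℝ)| := by exact_mod_cast h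
  rw [← sq_abs (x i : ℝ)]
  gcongr

/-- Summation over boxes by sup-norm shells. -/
theorem sum_lamF_le {d : ℕ} (F : Zd d → ℝ) (a : ℕ → ℝ)
    (hF : ∀ k : ℕ, ∀ x ∉ lamF d k, F x ≤ a k) (n : ℕ) :
    ∑ x ∈ lamF d n, F x ≤
      F 0 + ∑ k ∈ Finset.range n, ((2 * k + 3 : ℝ) ^ d - (2 * k + 1) ^ d) * a k := by
  induction n with
  | zero =>
    have h0 : lamF d 0 = {0} := by
      ext x
      simp only [mem_lamF, Nat.cast_zero, abs_nonpos_iff, Finset.mem_singleton, funext_iff,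
        Pi.zero_apply]
    simp [h0]
  | succ n ih =>
    have hsub := lamF_mono d n.le_succ
    rw [← Finset.sum_sdiff hsub, Finset.sum_range_succ]
    have hs : ∑ x ∈ lamF d (n + 1) \ lamF d n, F x ≤
        ((2 * n + 3 : ℝ) ^ d - (2 * n + 1) ^ d) * a n := by
      have hcard : ((lamF d (n + 1) \ lamF d n).card : ℝ) =
          (2 * n + 3 : ℝ) ^ d - (2 * n + 1) ^ d := by
        rw [Finset.cast_card_sdiff hsub, card_lamF, card_lamF]
        push_cast
        ring
      rw [← hcard, ← nsmul_eq_mul]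
      exact Finset.sum_le_card_nsmul _ _ _ fun x hx => hF n x (Finset.mem_sdiff.1 hx).2
    simp only [Nat.succ_eq_add_one]
    linarith

theorem trapK_eq {d : ℕ} {ρ : Zd d → ℝ} (x y : Zd d) :
    trapK ρ x y = ENNReal.ofReal ((if x = y then ρ x else 0) + (1 - ρ x) * srw x y) := by
  by_cases h : x = y
  · subst h
    simp [trapK, srw_self]
  · by_cases h1 : znorm (x - y) = 1 <;> simp [trapK, srw, h, h1, div_eq_mul_inv]

section Green

variable {d : ℕ} (p : Zd d → Zd d → ℝ≥0∞)

theorem tsum_kpow_eq (y : Zd d) :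
    ∑' k, kpow p k 0 y = (if (0 : Zd d) = y then 1 else 0) + ∑' z, (∑' k, kpow p k 0 z) * p z y := by
  rw [tsum_eq_zero_add' ENNReal.summable]
  simp only [kpow, ← ENNReal.tsum_mul_right]
  rw [ENNReal.tsum_comm]

/-- The Green's function is the smallest supersolution. -/
theorem tsum_kpow_le (u : Zd d → ℝ≥0∞)
    (hu : ∀ y, (if (0 : Zd d) = y then 1 else 0) + ∑' z, u z * p z y ≤ u y) (y : Zd d) :
    ∑' k, kpow p k 0 y ≤ u y := by
  rw [ENNReal.tsum_eq_iSup_nat]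
  refine iSup_le fun n => ?_
  induction n generalizing y with
  | zero => simp
  | succ n ih =>
    rw [Finset.sum_range_succ']
    refine le_trans ?_ (hu y)
    rw [add_comm]
    gcongr ?_ + ?_
    · simp [kpow]
    · simp only [kpow]
      rw [← Summable.tsum_finsetSum fun _ _ => ENNReal.summable]
      refine ENNReal.tsum_le_tsum fun z => ?_
      rw [← Finset.sum_mul]
      gcongr
      exact ih z

end Green

theorem tsum_mul_kill {d : ℕ} (p : Zd d → Zd d → ℝ≥0∞) (B : Finset (Zd d)) (u : Zd d → ℝ≥0∞)
    (y : Zd d) :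
    ∑' z, u z * kill p B z y = if y ∈ B then ∑ z ∈ B, u z * p z y else 0 := by
  rw [tsum_eq_sum (s := B)]
  · by_cases hy : y ∈ B
    · rw [if_pos hy]
      exact Finset.sum_congr rfl fun z hz => by simp [kill, hy, hz]
    · simp [kill, hy]
  · intro z hz
    simp [kill, hz]

/-- The killed Green's function of the trap walk is that of simple random walk: it is bounded by
multiples of superharmonic functions and solves the Poisson equation. -/
theorem exists_green {d : ℕ} {ρ : Zd d → ℝ} (hρ : ∀ x, ρ x ∈ Set.Ico (0 : ℝ) 1)
    (B : Finset (Zd d)) (hB : 0 ∈ B) (h : Zd d → ℝ) (hpos : ∀ x, 0 ≤ h x)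
    (hsup : ∀ x, nbrAvg h x ≤ h x) (h0 : nbrAvg h 0 + 1 ≤ h 0) :
    ∃ G : Zd d → ℝ, (∀ x, 0 ≤ G x) ∧ (∀ x, G x ≤ h x) ∧
      (∀ x, ∑' k, kpow (kill (trapK ρ) B) k 0 x / piT ρ x = ENNReal.ofReal (G x)) ∧
      ∀ x ∈ B, G x = (if (0 : Zd d) = x then 1 else 0) + ∑ z ∈ B, srw x z * G z := by
  have h1 : ∀ x, 0 < 1 - ρ x := fun x => sub_pos.2 (hρ x).2
  have hρ0 : ∀ x, 0 ≤ ρ x := fun x => (hρ x).1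
  set N : Zd d → ℝ≥0∞ := fun x => ∑' k, kpow (kill (trapK ρ) B) k 0 x with hN
  have hker : ∀ x y, 0 ≤ (if x = y then ρ x else 0) + (1 - ρ x) * srw x y := by
    intro x y
    have := mul_nonneg (h1 x).le (srw_nonneg x y)
    split_ifs
    · exact add_nonneg (hρ0 x) this
    · simpa using this
  have hsum : ∀ v : Zd d → ℝ, (∀ x, 0 ≤ v x) → ∀ y ∈ B,
      ∑ z ∈ B, ENNReal.ofReal (v z) * trapK ρ z y =
        ENNReal.ofReal (ρ y * v y + ∑ z ∈ B, srw y z * ((1 - ρ z) * v z)) := by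
    intro v hv y hy
    simp only [trapK_eq, ← ENNReal.ofReal_mul (hv _)]
    rw [← ENNReal.ofReal_sum_of_nonneg fun z _ => mul_nonneg (hv z) (hker z y)]
    congr 1
    simp only [mul_add, Finset.sum_add_distrib]
    congr 1
    · simp [hy, mul_comm]
    · exact Finset.sum_congr rfl fun z _ => by rw [srw_comm y z]; ring
  have hbound : ∀ y, N y ≤ ENNReal.ofReal ((1 - ρ y)⁻¹ * h y) := by
    refine tsum_kpow_le _ _ fun y => ?_
    rw [tsum_mul_kill]
    by_cases hy : y ∈ B
    · rw [if_pos hy, hsum _ (fun x => mul_nonneg (inv_nonneg.2 (h1 x).le) (hpos x)) y hy]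
      have e : ∑ z ∈ B, srw y z * ((1 - ρ z) * ((1 - ρ z)⁻¹ * h z)) = ∑ z ∈ B, srw y z * h z :=
        Finset.sum_congr rfl fun z _ => by rw [mul_inv_cancel_left₀ (h1 z).ne']
      rw [e]
      have hle := sum_srw_mul_le B y h hpos
      have hnn : 0 ≤ ∑ z ∈ B, srw y z * h z :=
        Finset.sum_nonneg fun z _ => mul_nonneg (srw_nonneg y z) (hpos z)
      have hident : (1 - ρ y)⁻¹ * h y = ρ y * ((1 - ρ y)⁻¹ * h y) + h y := by
        field_simp [(h1 y).ne']
        ring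
      have hnn2 : 0 ≤ ρ y * ((1 - ρ y)⁻¹ * h y) :=
        mul_nonneg (hρ0 y) (mul_nonneg (inv_nonneg.2 (h1 y).le) (hpos y))
      by_cases hy0 : (0 : Zd d) = y
      · rw [if_pos hy0, ← ENNReal.ofReal_one, ← ENNReal.ofReal_add zero_le_one (by linarith)]
        apply ENNReal.ofReal_le_ofReal
        subst hy0
        linarith
      · rw [if_neg hy0, zero_add]
        apply ENNReal.ofReal_le_ofReal
        linarith [hsup y]
    · have : (0 : Zd d) ≠ y := fun hc => hy (hc ▸ hB)
      simp [hy, this]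
  have hfin : ∀ y, N y ≠ ∞ := fun y => ((hbound y).trans_lt ENNReal.ofReal_lt_top).ne
  have hNr : ∀ y, N y = ENNReal.ofReal (N y).toReal := fun y => (ENNReal.ofReal_toReal (hfin y)).symm
  refine ⟨fun y => (1 - ρ y) * (N y).toReal,
    fun y => mul_nonneg (h1 y).le ENNReal.toReal_nonneg, fun y => ?_, fun y => ?_, fun y hy => ?_⟩
  · have := ENNReal.toReal_le_of_le_ofReal
      (mul_nonneg (inv_nonneg.2 (h1 y).le) (hpos y)) (hbound y)
    calc (1 - ρ y) * (N y).toReal ≤ (1 - ρ y) * ((1 - ρ y)⁻¹ * h y) := by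
          have := (h1 y).le
          gcongr
      _ = h y := mul_inv_cancel_left₀ (h1 y).ne' _
  · simp only [div_eq_mul_inv, ENNReal.tsum_mul_right]
    change N y * _ = _
    rw [piT, ENNReal.ofReal_inv_of_pos (h1 y), inv_inv, ENNReal.ofReal_mul (h1 y).le, ← hNr,
      mul_comm]
  · have heq : N y = (if (0 : Zd d) = y then 1 else 0) + ∑' z, N z * kill (trapK ρ) B z y :=
      tsum_kpow_eq _ y
    rw [tsum_mul_kill, if_pos hy, Finset.sum_congr rfl fun z _ => by rw [hNr z],
      hsum _ (fun _ => ENNReal.toReal_nonneg) y hy] at heq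
    have hnn : 0 ≤ ρ y * (N y).toReal + ∑ z ∈ B, srw y z * ((1 - ρ z) * (N z).toReal) :=
      add_nonneg (mul_nonneg (hρ0 y) ENNReal.toReal_nonneg) (Finset.sum_nonneg fun z _ =>
        mul_nonneg (srw_nonneg y z) (mul_nonneg (h1 z).le ENNReal.toReal_nonneg))
    have hr := congrArg ENNReal.toReal heq
    rw [ENNReal.toReal_add (by split_ifs <;> simp) ENNReal.ofReal_ne_top,
      ENNReal.toReal_ofReal hnn] at hr
    have hite : (if (0 : Zd d) = y then (1 : ℝ≥0∞) else 0).toReal =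
        if (0 : Zd d) = y then 1 else 0 := by split_ifs <;> simp
    rw [hite] at hr
    linarith

/-- Exit estimate: the Green's function integrates `w` to at least `M` times the probability of
leaving the box before being killed, if `L` grows by at most `w` and is at least `M` outside. -/
theorem le_sum_green_mul {d m : ℕ} (hd : 0 < d) (B : Finset (Zd d)) (hBm : B ⊆ lamF d m)
    (hB : 0 ∈ B) (h G L w : Zd d → ℝ) (M : ℝ) (hpos : ∀ x, 0 ≤ h x)
    (hsup : ∀ x, nbrAvg h x ≤ h x) (hG0 : ∀ x, 0 ≤ G x) (hGh : ∀ x, G x ≤ h x)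
    (hG : ∀ x ∈ B, G x = (if (0 : Zd d) = x then 1 else 0) + ∑ z ∈ B, srw x z * G z)
    (hL0 : L 0 = 0) (hL : ∀ x, 0 ≤ L x) (hM : 0 ≤ M) (hLM : ∀ x ∉ lamF d m, M ≤ L x)
    (hLw : ∀ x, nbrAvg L x ≤ L x + w x) :
    M * (1 - ∑ x ∈ lamF d m \ B, h x) ≤ ∑ x ∈ B, G x * w x := by
  set D := lamF d (m + 1)
  have hmD : lamF d m ⊆ D := lamF_mono d m.le_succ
  set H : Zd d → ℝ := fun z => ∑ y ∈ B, srw z y * G y with hH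
  have hH0 : ∀ z, 0 ≤ H z := fun z =>
    Finset.sum_nonneg fun y _ => mul_nonneg (srw_nonneg z y) (hG0 y)
  have hHh : ∀ z, H z ≤ h z := fun z => by
    refine le_trans (Finset.sum_le_sum fun y _ => ?_) ((sum_srw_mul_le B z h hpos).trans (hsup z))
    exact mul_le_mul_of_nonneg_left (hGh y) (srw_nonneg z y)
  have hdual : ∀ f : Zd d → ℝ, ∑ y ∈ B, G y * nbrAvg f y =
      ∑ z ∈ B, G z * f z - f 0 + ∑ z ∈ D \ B, f z * H z := by
    intro f
    have e1 : ∑ y ∈ B, G y * nbrAvg f y = ∑ z ∈ D, f z * H z := by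
      have : ∀ y ∈ B, G y * nbrAvg f y = ∑ z ∈ D, G y * (srw y z * f z) := fun y hy => by
        rw [← sum_srw_mul D y (nbr_mem_lamF (hBm hy)), Finset.mul_sum]
      rw [Finset.sum_congr rfl this, Finset.sum_comm]
      refine Finset.sum_congr rfl fun z _ => ?_
      rw [hH, Finset.mul_sum]
      exact Finset.sum_congr rfl fun y _ => by rw [srw_comm y z]; ring
    have e2 : ∑ z ∈ B, f z * H z = ∑ z ∈ B, G z * f z - f 0 := by
      have : ∀ z ∈ B, f z * H z = G z * f z - if (0 : Zd d) = z then f z else 0 := by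
        intro z hz
        rw [hG z hz]
        split_ifs <;> ring
      rw [Finset.sum_congr rfl this, Finset.sum_sub_distrib, Finset.sum_ite_eq, if_pos hB]
    rw [e1, ← Finset.sum_sdiff (hBm.trans hmD), e2]
    ring
  have hone : ∑ z ∈ D \ B, H z = 1 := by
    have := hdual fun _ => 1
    have hc : ∀ y : Zd d, nbrAvg (fun _ => (1 : ℝ)) y = 1 := fun y => by
      have : (d : ℝ) ≠ 0 := by positivity
      simp only [nbrAvg, Finset.sum_const, Finset.card_univ, Fintype.card_prod, Fintype.card_fin,
        Fintype.card_bool, nsmul_eq_mul, mul_one]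
      push_cast
      field_simp
    simp only [hc, mul_one, one_mul] at this
    linarith
  have hsplit : ∀ f : Zd d → ℝ,
      ∑ z ∈ D \ B, f z = ∑ z ∈ D \ lamF d m, f z + ∑ z ∈ lamF d m \ B, f z := by
    intro f
    rw [← Finset.sum_sdiff (Finset.sdiff_subset_sdiff hmD (le_refl B))]
    congr 2
    ext z
    have := @hBm z
    simp only [Finset.mem_sdiff]
    tauto
  have hout : ∑ z ∈ D \ lamF d m, M * H z ≤ ∑ z ∈ D \ lamF d m, L z * H z :=
    Finset.sum_le_sum fun z hz =>
      mul_le_mul_of_nonneg_right (hLM z (Finset.mem_sdiff.1 hz).2) (hH0 z)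
  have hin : 0 ≤ ∑ z ∈ lamF d m \ B, L z * H z :=
    Finset.sum_nonneg fun z _ => mul_nonneg (hL z) (hH0 z)
  have hq : ∑ z ∈ lamF d m \ B, H z ≤ ∑ z ∈ lamF d m \ B, h z :=
    Finset.sum_le_sum fun z _ => hHh z
  have hLd := hdual L
  have hLs := hsplit fun z => L z * H z
  have hHs := hsplit H
  have hw : ∑ y ∈ B, G y * nbrAvg L y ≤ ∑ y ∈ B, G y * L y + ∑ y ∈ B, G y * w y := by
    rw [← Finset.sum_add_distrib]
    refine Finset.sum_le_sum fun y _ => ?_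
    rw [← mul_add]
    exact mul_le_mul_of_nonneg_left (hLw y) (hG0 y)
  rw [← Finset.mul_sum] at hout
  have hM2 : M * (1 - ∑ x ∈ lamF d m \ B, h x) ≤ M * ∑ z ∈ D \ lamF d m, H z :=
    mul_le_mul_of_nonneg_left (by linarith) hM
  linarith

theorem one_le_piT {d : ℕ} {ρ : Zd d → ℝ} (hρ : ∀ x, ρ x ∈ Set.Ico (0 : ℝ) 1) (x : Zd d) :
    1 ≤ piT ρ x := by
  rw [piT, ENNReal.one_le_ofReal]
  exact (one_le_inv₀ (sub_pos.2 (hρ x).2)).2 (by linarith [(hρ x).1])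

/-- Quenched lower bound: the error term is the expected number of deep traps in the box, weighted
by a superharmonic function. -/
theorem le_sum_piT_mul_gKillTrap_sq {d m : ℕ} (hd : 0 < d) {ρ : Zd d → ℝ}
    (hρ : ∀ x, ρ x ∈ Set.Ico (0 : ℝ) 1) (R : ℝ) (h L w : Zd d → ℝ) (M W : ℝ)
    (hpos : ∀ x, 0 ≤ h x) (hsup : ∀ x, nbrAvg h x ≤ h x) (h0 : nbrAvg h 0 + 1 ≤ h 0)
    (hL0 : L 0 = 0) (hL : ∀ x, 0 ≤ L x) (hM : 0 ≤ M) (hLM : ∀ x ∉ lamF d m, M ≤ L x)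
    (hLw : ∀ x, nbrAvg L x ≤ L x + w x) (hW0 : 0 < W) (hW : ∑ x ∈ lamF d m, w x ^ 2 ≤ W) :
    ENNReal.ofReal (M ^ 2 / W) ≤ ∑ x ∈ lamF d m, piT ρ x * gKillTrap ρ R m 0 x ^ 2 +
      ENNReal.ofReal (M ^ 2 / W) *
        (2 * ∑ x ∈ lamF d m, if x ∈ Atrap R ρ then ENNReal.ofReal (h x) else 0) := by
  set B := (lamF d m).filter (· ∉ Atrap R ρ) with hBdef
  set q := ∑ x ∈ lamF d m \ B, h x with hq
  set c := M ^ 2 / W with hc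
  have hc0 : 0 ≤ c := by positivity
  have hq0 : 0 ≤ q := Finset.sum_nonneg fun x _ => hpos x
  have hBA : lamF d m \ B = (lamF d m).filter (· ∈ Atrap R ρ) := by
    ext x
    simp only [hBdef, Finset.mem_sdiff, Finset.mem_filter]
    tauto
  have hqE : ∑ x ∈ lamF d m, (if x ∈ Atrap R ρ then ENNReal.ofReal (h x) else 0) =
      ENNReal.ofReal q := by
    rw [hq, hBA, ENNReal.ofReal_sum_of_nonneg fun x _ => hpos x, Finset.sum_filter]
  have hset : ((lamF d m : Set (Zd d)) \ Atrap R ρ) = (B : Set (Zd d)) := by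
    ext x
    simp [hBdef]
  have h2q : (2 : ℝ≥0∞) * ENNReal.ofReal q = ENNReal.ofReal (2 * q) := by
    rw [ENNReal.ofReal_mul zero_le_two, ENNReal.ofReal_ofNat]
  rw [hqE, h2q, ← ENNReal.ofReal_mul hc0]
  by_cases hq1 : 1 ≤ 2 * q
  · exact le_add_left (ENNReal.ofReal_le_ofReal (le_mul_of_one_le_right hc0 hq1))
  have hB0 : (0 : Zd d) ∈ B := by
    by_contra hcon
    have h0m : (0 : Zd d) ∈ lamF d m := by simp [mem_lamF]
    have : h 0 ≤ q := Finset.single_le_sum (fun x _ => hpos x) (Finset.mem_sdiff.2 ⟨h0m, hcon⟩)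
    have : 0 ≤ nbrAvg h 0 := div_nonneg (Finset.sum_nonneg fun _ _ => hpos _) (by positivity)
    linarith
  have hBm : B ⊆ lamF d m := Finset.filter_subset _ _
  obtain ⟨G, hG0, hGh, hGk, hG⟩ := exists_green hρ B hB0 h hpos hsup h0
  have key := le_sum_green_mul hd B hBm hB0 h G L w M hpos hsup hG0 hGh hG hL0 hL hM hLM hLw
  rw [← hq] at key
  have hS : c ≤ ∑ x ∈ B, G x ^ 2 + c * (2 * q) := by
    have hcs := Finset.sum_mul_sq_le_sq_mul_sq B G w
    have hwB : ∑ x ∈ B, w x ^ 2 ≤ W :=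
      (Finset.sum_le_sum_of_subset_of_nonneg hBm fun _ _ _ => sq_nonneg _).trans hW
    have hSnn : 0 ≤ ∑ x ∈ B, G x ^ 2 := Finset.sum_nonneg fun _ _ => sq_nonneg _
    have h1 : (M * (1 - q)) ^ 2 ≤ (∑ x ∈ B, G x ^ 2) * W :=
      (pow_le_pow_left₀ (mul_nonneg hM (by linarith)) key 2).trans
        (hcs.trans (mul_le_mul_of_nonneg_left hwB hSnn))
    have h2 : M ^ 2 * (1 - q) ^ 2 / W ≤ ∑ x ∈ B, G x ^ 2 := by
      rw [div_le_iff₀ hW0]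
      linarith
    have h3 : M ^ 2 * (1 - q) ^ 2 / W = c * (1 - q) ^ 2 := by
      rw [hc]
      ring
    nlinarith [mul_nonneg hc0 (sq_nonneg q)]
  refine (ENNReal.ofReal_le_ofReal hS).trans ?_
  rw [ENNReal.ofReal_add (Finset.sum_nonneg fun _ _ => sq_nonneg _) (by positivity)]
  gcongr
  rw [ENNReal.ofReal_sum_of_nonneg fun _ _ => sq_nonneg _]
  refine le_trans (Finset.sum_le_sum fun x _ => ?_) (Finset.sum_le_sum_of_subset hBm)
  rw [gKillTrap, hset, hGk, ← ENNReal.ofReal_pow (hG0 x)]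
  exact le_mul_of_one_le_left zero_le (one_le_piT hρ x)

theorem sum_deep_le {d : ℕ} (m : ℕ) (R C t : ℝ) (hR : 0 < R) (hC : 0 ≤ C) (h : Zd d → ℝ)
    (hpos : ∀ x, 0 ≤ h x) (hsum : ∀ r : ℕ, 1 ≤ r → ∑ x ∈ lamF d r, h x ≤ C * r ^ 2) :
    ∑ x ∈ lamF d m, (if R * max (znorm x) 1 ^ 2 ≤ t then ENNReal.ofReal (h x) else 0) ≤
      ENNReal.ofReal (C / R) * ENNReal.ofReal t := by
  rw [← ENNReal.ofReal_mul (by positivity), ← Finset.sum_filter,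
    ← ENNReal.ofReal_sum_of_nonneg fun x _ => hpos x]
  by_cases htR : R ≤ t
  · have hT : 1 ≤ t / R := (one_le_div₀ hR).2 htR
    set r := ⌊√(t / R)⌋₊ with hr
    have hr1 : 1 ≤ r := Nat.le_floor (by simpa using Real.one_le_sqrt.2 hT)
    have hsub : (lamF d m).filter (fun x => R * max (znorm x) 1 ^ 2 ≤ t) ⊆ lamF d r := by
      intro x hx
      have hx2 := (Finset.mem_filter.1 hx).2
      rw [mem_lamF]
      intro i
      have h1 : max (znorm x) 1 ^ 2 ≤ t / R := by
        rw [le_div_iff₀ hR]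
        linarith
      have h2 : znorm x ^ 2 ≤ max (znorm x) 1 ^ 2 :=
        pow_le_pow_left₀ (Real.sqrt_nonneg _) (le_max_left _ _) 2
      have h3 : |(x i : ℝ)| ≤ √(t / R) :=
        Real.abs_le_sqrt ((sq_le_znorm_sq x i).trans (h2.trans h1))
      have h4 : ((x i).natAbs : ℝ) ≤ √(t / R) := by rwa [Nat.cast_natAbs, Int.cast_abs]
      have h5 : (x i).natAbs ≤ r := Nat.le_floor h4
      rw [Int.abs_eq_natAbs]
      exact_mod_cast h5
    apply ENNReal.ofReal_le_ofReal
    calc _ ≤ ∑ x ∈ lamF d r, h x :=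
          Finset.sum_le_sum_of_subset_of_nonneg hsub fun x _ _ => hpos x
      _ ≤ C * r ^ 2 := hsum r hr1
      _ ≤ C * (t / R) := by
          have : (r : ℝ) ≤ √(t / R) := Nat.floor_le (Real.sqrt_nonneg _)
          have h2 : (r : ℝ) ^ 2 ≤ √(t / R) ^ 2 := by gcongr
          rw [Real.sq_sqrt (by linarith)] at h2
          gcongr
      _ = C / R * t := by ring
  · rw [Finset.filter_false_of_mem, Finset.sum_empty, ENNReal.ofReal_zero]
    · exact zero_le
    · intro x _ hx
      have : 1 ≤ max (znorm x) 1 ^ 2 := one_le_pow₀ (le_max_right _ _)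
      exact htR ((le_mul_of_one_le_right hR.le this).trans hx)

theorem mem_Atrap {d : ℕ} (R : ℝ) (ρ : Zd d → ℝ) (x : Zd d) :
    x ∈ Atrap R ρ ↔ R * max (znorm x) 1 ^ 2 ≤ (1 - ρ x)⁻¹ := Iff.rfl

theorem measurable_deep {d : ℕ} (R a : ℝ) (x y : Zd d) :
    Measurable fun ρ : Zd d → ℝ =>
      if R * max (znorm x) 1 ^ 2 ≤ (1 - ρ y)⁻¹ then ENNReal.ofReal a else 0 :=
  Measurable.ite (measurableSet_le measurable_const
    ((measurable_const.sub (measurable_pi_apply y)).inv)) measurable_const measurable_const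

/-- Annealed bound on the weighted number of deep traps. -/
theorem lintegral_sum_Atrap_le {d : ℕ} (P : Measure (Zd d → ℝ))
    (hstat : ∀ z : Zd d, P.map (fun ρ x => ρ (x + z)) = P) (m : ℕ) (R C : ℝ) (hR : 0 < R)
    (hC : 0 ≤ C) (h : Zd d → ℝ) (hpos : ∀ x, 0 ≤ h x)
    (hsum : ∀ r : ℕ, 1 ≤ r → ∑ x ∈ lamF d r, h x ≤ C * r ^ 2) :
    ∫⁻ ρ, ∑ x ∈ lamF d m, (if x ∈ Atrap R ρ then ENNReal.ofReal (h x) else 0) ∂P ≤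
      ENNReal.ofReal (C / R) * ∫⁻ ρ, piT ρ 0 ∂P := by
  have hmeas : ∀ z : Zd d, Measurable fun (ρ : Zd d → ℝ) x => ρ (x + z) := fun z =>
    measurable_pi_lambda _ fun x => measurable_pi_apply _
  simp only [mem_Atrap]
  rw [lintegral_finsetSum _ fun x _ => measurable_deep R _ x x]
  have hshift : ∀ x : Zd d,
      ∫⁻ ρ, (if R * max (znorm x) 1 ^ 2 ≤ (1 - ρ x)⁻¹ then ENNReal.ofReal (h x) else 0) ∂P =
      ∫⁻ ρ, (if R * max (znorm x) 1 ^ 2 ≤ (1 - ρ 0)⁻¹ then ENNReal.ofReal (h x) else 0) ∂P := by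
    intro x
    conv_rhs => rw [← hstat x]
    rw [lintegral_map (measurable_deep R _ x 0) (hmeas x)]
    simp only [zero_add]
  simp only [hshift]
  rw [← lintegral_finsetSum _ fun x _ => measurable_deep R _ x 0,
    ← lintegral_const_mul' _ _ ENNReal.ofReal_ne_top]
  exact lintegral_mono fun ρ => sum_deep_le m R C _ hR hC h hpos hsum

/-- Annealed lower bound, given a superharmonic function with quadratically growing sums. -/
theorem exists_annealed_bound {d : ℕ} (hd : 0 < d) (P : Measure (Zd d → ℝ))
    [IsProbabilityMeasure P] (hrange : ∀ᵐ ρ ∂P, ∀ x, ρ x ∈ Set.Ico (0 : ℝ) 1)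
    (hstat : ∀ z : Zd d, P.map (fun ρ x => ρ (x + z)) = P) (hint : ∫⁻ ρ, piT ρ 0 ∂P < ∞)
    (h : Zd d → ℝ) (hpos : ∀ x, 0 ≤ h x) (hsup : ∀ x, nbrAvg h x ≤ h x)
    (h0 : nbrAvg h 0 < h 0) (C : ℝ) (hC : 0 ≤ C)
    (hsum : ∀ r : ℕ, 1 ≤ r → ∑ x ∈ lamF d r, h x ≤ C * r ^ 2) :
    ∃ R : ℝ, 0 < R ∧ ∀ (m : ℕ) (L w : Zd d → ℝ) (M W : ℝ), L 0 = 0 → (∀ x, 0 ≤ L x) → 0 ≤ M →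
      (∀ x ∉ lamF d m, M ≤ L x) → (∀ x, nbrAvg L x ≤ L x + w x) → 0 < W →
      ∑ x ∈ lamF d m, w x ^ 2 ≤ W →
      ENNReal.ofReal (M ^ 2 / W / 2) ≤
        ∫⁻ ρ, ∑ x ∈ lamF d m, piT ρ x * gKillTrap ρ R m 0 x ^ 2 ∂P := by
  set κ := h 0 - nbrAvg h 0 with hκ
  have hκ0 : 0 < κ := sub_pos.2 h0
  set h' : Zd d → ℝ := fun x => h x / κ with hh'
  have havg : ∀ x, nbrAvg h' x = nbrAvg h x / κ := fun x => by
    simp only [nbrAvg, hh', ← Finset.sum_div]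
    ring
  have hpos' : ∀ x, 0 ≤ h' x := fun x => div_nonneg (hpos x) hκ0.le
  have hsup' : ∀ x, nbrAvg h' x ≤ h' x := fun x => by
    rw [havg]
    exact div_le_div_of_nonneg_right (hsup x) hκ0.le
  have h0' : nbrAvg h' 0 + 1 ≤ h' 0 := by
    rw [havg, hh', div_add_one hκ0.ne']
    exact div_le_div_of_nonneg_right (by linarith) hκ0.le
  have hsum' : ∀ r : ℕ, 1 ≤ r → ∑ x ∈ lamF d r, h' x ≤ C / κ * r ^ 2 := fun r hr => by
    rw [hh', ← Finset.sum_div, div_mul_eq_mul_div]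
    exact div_le_div_of_nonneg_right (hsum r hr) hκ0.le
  have hC' : 0 ≤ C / κ := div_nonneg hC hκ0.le
  set e := (∫⁻ ρ, piT ρ 0 ∂P).toReal with he
  have he0 : 0 ≤ e := ENNReal.toReal_nonneg
  set R := 4 * (C / κ) * e + 1 with hRdef
  have hR : 0 < R := by positivity
  refine ⟨R, hR, fun m L w M W hL0 hL hM hLM hLw hW0 hW => ?_⟩
  set c := M ^ 2 / W
  have hc0 : 0 ≤ c := by positivity
  set q : (Zd d → ℝ) → ℝ≥0∞ :=
    fun ρ => ∑ x ∈ lamF d m, (if x ∈ Atrap R ρ then ENNReal.ofReal (h' x) else 0) with hqdef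
  have hqm : Measurable q := Finset.measurable_fun_sum _ fun x _ => measurable_deep R _ x x
  have hq : ∫⁻ ρ, q ρ ∂P ≤ ENNReal.ofReal (1 / 4) := by
    refine (lintegral_sum_Atrap_le P hstat m R (C / κ) hR hC' h' hpos' hsum').trans ?_
    rw [← ENNReal.ofReal_toReal hint.ne, ← ENNReal.ofReal_mul (by positivity)]
    apply ENNReal.ofReal_le_ofReal
    rw [div_mul_eq_mul_div, div_le_iff₀ hR, hRdef]
    linarith
  have hquenched : ∀ᵐ ρ ∂P, ENNReal.ofReal c ≤
      ∑ x ∈ lamF d m, piT ρ x * gKillTrap ρ R m 0 x ^ 2 + ENNReal.ofReal c * (2 * q ρ) := by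
    filter_upwards [hrange] with ρ hρ
    exact le_sum_piT_mul_gKillTrap_sq hd hρ R h' L w M W hpos' hsup' h0' hL0 hL hM hLM hLw hW0 hW
  have hI := lintegral_mono_ae hquenched
  rw [lintegral_const, measure_univ, mul_one,
    lintegral_add_right _ ((hqm.const_mul 2).const_mul _),
    lintegral_const_mul _ (hqm.const_mul 2), lintegral_const_mul _ hqm] at hI
  have hhalf : ENNReal.ofReal c * (2 * ∫⁻ ρ, q ρ ∂P) ≤ ENNReal.ofReal (c / 2) := by
    calc _ ≤ ENNReal.ofReal c * (ENNReal.ofReal 2 * ENNReal.ofReal (1 / 4)) := by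
          rw [ENNReal.ofReal_ofNat]
          gcongr
      _ = ENNReal.ofReal (c / 2) := by
          rw [← ENNReal.ofReal_mul zero_le_two, ← ENNReal.ofReal_mul hc0]
          congr 1
          ring
  have hfin := hI.trans (add_le_add_right hhalf _)
  have hcc : ENNReal.ofReal c = ENNReal.ofReal (c / 2) + ENNReal.ofReal (c / 2) := by
    rw [← ENNReal.ofReal_add (by positivity) (by positivity), add_halves]
  rw [hcc] at hfin
  exact (ENNReal.add_le_add_iff_right ENNReal.ofReal_ne_top).1 hfin

theorem znorm_sq_nbr {d : ℕ} (x : Zd d) (i : Fin d) (b : Bool) :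
    znorm (nbr x (i, b)) ^ 2 = znorm x ^ 2 + 1 + (if b then 1 else -1) * (2 * x i) := by
  have h : ∀ j, ((nbr x (i, b) j : ℤ) : ℝ) ^ 2 =
      (x j : ℝ) ^ 2 + if i = j then 1 + (if b then 1 else -1) * (2 * (x j : ℝ)) else 0 := by
    intro j
    by_cases hj : i = j
    · subst hj
      cases b <;> simp [nbr] <;> ring
    · have : j ≠ i := Ne.symm hj
      simp [nbr, hj, this]
  rw [znorm_sq, znorm_sq, Finset.sum_congr rfl fun j _ => h j, Finset.sum_add_distrib,
    Finset.sum_ite_eq, if_pos (Finset.mem_univ i)]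
  ring

theorem nbrAvg_radial {d : ℕ} (φ : ℝ → ℝ) (x : Zd d) :
    nbrAvg (fun y => φ (znorm y ^ 2)) x =
      (∑ i, (φ (znorm x ^ 2 + 1 + 2 * x i) + φ (znorm x ^ 2 + 1 - 2 * x i))) / (2 * d) := by
  simp only [nbrAvg, Fintype.sum_prod_type, Fintype.sum_bool, znorm_sq_nbr]
  congr 1
  refine Finset.sum_congr rfl fun i _ => ?_
  simp [sub_eq_add_neg]

/-- Concave radial functions grow at most by their derivative. -/
theorem nbrAvg_radial_le_add {d : ℕ} (hd : 0 < d) (φ : ℝ → ℝ) (x : Zd d) (a : ℝ)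
    (hφ : ∀ u, 0 ≤ u → φ u ≤ φ (znorm x ^ 2) + a * (u - znorm x ^ 2)) :
    nbrAvg (fun y => φ (znorm y ^ 2)) x ≤ φ (znorm x ^ 2) + a := by
  have hd' : (0 : ℝ) < d := by exact_mod_cast hd
  rw [nbrAvg_radial, div_le_iff₀ (by positivity)]
  have h : ∀ i ∈ Finset.univ, φ (znorm x ^ 2 + 1 + 2 * x i) + φ (znorm x ^ 2 + 1 - 2 * x i) ≤
      2 * (φ (znorm x ^ 2) + a) := by
    intro i _
    have hi := sq_le_znorm_sq x i
    have h1 := hφ (znorm x ^ 2 + 1 + 2 * x i) (by nlinarith [sq_nonneg ((x i : ℝ) + 1)])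
    have h2 := hφ (znorm x ^ 2 + 1 - 2 * x i) (by nlinarith [sq_nonneg ((x i : ℝ) - 1)])
    linarith
  have := Finset.sum_le_card_nsmul _ _ _ h
  simp only [Finset.card_univ, Fintype.card_fin, nsmul_eq_mul] at this
  linarith

theorem nbrAvg_radial_le_mul {d : ℕ} (hd : 0 < d) (φ : ℝ → ℝ) (A α β : ℝ) (hA : 0 ≤ A) (hβ : 0 ≤ β)
    (x : Zd d) (v : ℝ) (hv : v = znorm x ^ 2 + 17)
    (hφ : ∀ b : ℝ, |b| ≤ 1 / 2 →
      φ (v - 16 + v * b) + φ (v - 16 - v * b) ≤ 2 * A * (1 + α * b ^ 2 + β * b ^ 4)) :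
    nbrAvg (fun y => φ (znorm y ^ 2)) x ≤
      A * (1 + (α * (4 * (v - 17) / v ^ 2) + β * (16 / v ^ 2)) / d) := by
  have hd' : (0 : ℝ) < d := by exact_mod_cast hd
  have hx0 := sq_nonneg (znorm x)
  have hv0 : 0 < v := by linarith
  set b : Fin d → ℝ := fun i => 2 * x i / v with hb
  have hvb : ∀ i, v * b i = 2 * x i := fun i => mul_div_cancel₀ _ hv0.ne'
  have hbsq : ∀ i, b i ^ 2 = 4 * (x i : ℝ) ^ 2 / v ^ 2 := fun i => by
    rw [hb]
    ring
  have hbs : ∀ i, |b i| ≤ 1 / 2 := fun i => by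
    refine abs_le_of_sq_le_sq ?_ (by norm_num)
    rw [hbsq, div_le_iff₀ (by positivity)]
    nlinarith [sq_le_znorm_sq x i, sq_nonneg (v - 8)]
  have hsum2 : ∑ i, b i ^ 2 = 4 * (v - 17) / v ^ 2 := by
    simp only [hbsq]
    rw [← Finset.sum_div, ← Finset.mul_sum, ← znorm_sq, hv]
    ring
  have hsum4 : ∑ i, b i ^ 4 ≤ 16 / v ^ 2 := by
    calc ∑ i, b i ^ 4 = ∑ i, (b i ^ 2) ^ 2 := Finset.sum_congr rfl fun i _ => by ring
      _ ≤ (∑ i, b i ^ 2) ^ 2 := Finset.sum_sq_le_sq_sum_of_nonneg fun i _ => sq_nonneg _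
      _ = 16 * (v - 17) ^ 2 / v ^ 4 := by rw [hsum2]; ring
      _ ≤ 16 / v ^ 2 := by
        rw [div_le_div_iff₀ (by positivity) (by positivity)]
        nlinarith [mul_nonneg (sq_nonneg v) (by nlinarith : 0 ≤ v ^ 2 - (v - 17) ^ 2)]
  rw [nbrAvg_radial, div_le_iff₀ (by positivity)]
  have hterm : ∀ i, φ (znorm x ^ 2 + 1 + 2 * x i) + φ (znorm x ^ 2 + 1 - 2 * x i) ≤
      2 * A * (1 + α * b i ^ 2 + β * b i ^ 4) := fun i => by
    have := hφ (b i) (hbs i)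
    rw [hvb, hv] at this
    convert this using 3 <;> ring
  refine (Finset.sum_le_sum fun i _ => hterm i).trans ?_
  rw [← Finset.mul_sum]
  simp only [Finset.sum_add_distrib, ← Finset.mul_sum, Finset.sum_const, Finset.card_univ,
    Fintype.card_fin, nsmul_eq_mul, mul_one]
  rw [hsum2]
  have e : A * (1 + (α * (4 * (v - 17) / v ^ 2) + β * (16 / v ^ 2)) / d) * (2 * d) =
      2 * A * (d + α * (4 * (v - 17) / v ^ 2) + β * (16 / v ^ 2)) := by
    field_simp
    ring
  rw [e]
  gcongr

theorem inv_sqrt_one_add_le (b : ℝ) (hb : |b| ≤ 1 / 2) :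
    (√(1 + b))⁻¹ ≤ 1 - b / 2 + 3 / 8 * b ^ 2 - 5 / 16 * b ^ 3 + b ^ 4 := by
  obtain ⟨h1, h2⟩ := abs_le.1 hb
  have hpos : 0 < 1 + b := by linarith
  set Q := 1 - b / 2 + 3 / 8 * b ^ 2 - 5 / 16 * b ^ 3 + b ^ 4 with hQ
  have hQ0 : 0 ≤ Q := by
    have : 0 ≤ b ^ 2 * (3 / 8 - 5 / 16 * b) := mul_nonneg (sq_nonneg b) (by linarith)
    nlinarith [sq_nonneg (b ^ 2)]
  have hQ1 : 1 ≤ Q ^ 2 * (1 + b) := by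
    have hR : 0 ≤ Q ^ 2 * (1 + b) - 1 := by
      have e : Q ^ 2 * (1 + b) - 1 = b ^ 4 *
          (93 / 64 + 39 / 32 * b - 99 / 256 * b ^ 2 + 57 / 256 * b ^ 3 + 3 / 8 * b ^ 4 + b ^ 5) := by
        rw [hQ]
        ring
      rw [e]
      refine mul_nonneg (by positivity) ?_
      nlinarith [sq_nonneg b, sq_nonneg (b ^ 2), mul_nonneg (sq_nonneg b) (by linarith : 0 ≤ 1 / 2 + b),
        mul_nonneg (sq_nonneg (b ^ 2)) (by linarith : 0 ≤ 1 / 2 + b)]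
    linarith
  rw [inv_le_iff_one_le_mul₀ (Real.sqrt_pos.2 hpos)]
  refine le_of_sq_le_sq ?_ (by positivity)
  rw [mul_pow, Real.sq_sqrt hpos.le]
  linarith

theorem superharmonic_three (x : Zd 3) :
    nbrAvg (fun y : Zd 3 => (√(znorm y ^ 2 + 16))⁻¹) x ≤ (√(znorm x ^ 2 + 16))⁻¹ := by
  set v := znorm x ^ 2 + 17 with hv
  have hv17 : 17 ≤ v := by have := sq_nonneg (znorm x); linarith
  have hs : znorm x ^ 2 + 16 = v - 1 := by rw [hv]; ring
  refine (nbrAvg_radial_le_mul (by norm_num) (fun u => (√(u + 16))⁻¹) (√v)⁻¹ (3 / 8) 1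
    (by positivity) zero_le_one x v hv fun b hb => ?_).trans ?_
  · have e1 : v - 16 + v * b + 16 = v * (1 + b) := by ring
    have e2 : v - 16 - v * b + 16 = v * (1 + -b) := by ring
    rw [e1, e2, Real.sqrt_mul (by linarith), Real.sqrt_mul (by linarith), mul_inv, mul_inv]
    have h1 := inv_sqrt_one_add_le b hb
    have h2 := inv_sqrt_one_add_le (-b) (by rwa [abs_neg])
    rw [← mul_add, mul_comm 2, mul_assoc]
    have : 0 ≤ (√v)⁻¹ := by positivity
    gcongr
    linarith
  · rw [hs]
    have hv0 : 0 < v := by linarith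
    have hw0 : 0 < v - 1 := by linarith
    have h1 : 1 + (3 / 8 * (4 * (v - 17) / v ^ 2) + 1 * (16 / v ^ 2)) / ((3 : ℕ) : ℝ) ≤
        1 + 1 / (2 * v) := by
      have : 1 / (2 * v) - (3 / 8 * (4 * (v - 17) / v ^ 2) + 1 * (16 / v ^ 2)) / ((3 : ℕ) : ℝ) =
          (19 / 6) / v ^ 2 := by
        push_cast
        field_simp
        ring
      have h2 : 0 ≤ (19 / 6) / v ^ 2 := by positivity
      linarith
    have h2 : (1 + 1 / (2 * v)) * √(v - 1) ≤ √v := by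
      apply Real.le_sqrt_of_sq_le
      rw [mul_pow, Real.sq_sqrt hw0.le]
      have : v - (1 + 1 / (2 * v)) ^ 2 * (v - 1) = (3 * v + 1) / (4 * v ^ 2) := by
        field_simp
        ring
      have h3 : 0 ≤ (3 * v + 1) / (4 * v ^ 2) := by positivity
      linarith
    refine (mul_le_mul_of_nonneg_left h1 (by positivity)).trans ?_
    rw [← div_eq_inv_mul, div_le_iff₀ (Real.sqrt_pos.2 hv0), ← div_eq_inv_mul,
      le_div_iff₀ (Real.sqrt_pos.2 hw0)]
    exact h2

theorem superharmonic_four (x : Zd 4) :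
    nbrAvg (fun y : Zd 4 => (znorm y ^ 2 + 16)⁻¹) x ≤ (znorm x ^ 2 + 16)⁻¹ := by
  set v := znorm x ^ 2 + 17 with hv
  have hv17 : 17 ≤ v := by have := sq_nonneg (znorm x); linarith
  have hs : znorm x ^ 2 + 16 = v - 1 := by rw [hv]; ring
  refine (nbrAvg_radial_le_mul (by norm_num) (fun u => (u + 16)⁻¹) v⁻¹ 1 2
    (by positivity) zero_le_two x v hv fun b hb => ?_).trans ?_
  · have e1 : v - 16 + v * b + 16 = v * (1 + b) := by ring
    have e2 : v - 16 - v * b + 16 = v * (1 - b) := by ring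
    rw [e1, e2, mul_inv, mul_inv, ← mul_add, mul_comm 2, mul_assoc]
    obtain ⟨h1, h2⟩ := abs_le.1 hb
    have hb1 : 0 < 1 + b := by linarith
    have hb2 : 0 < 1 - b := by linarith
    have hbb : b ^ 2 ≤ 1 / 4 := by nlinarith
    have : 0 ≤ v⁻¹ := by positivity
    gcongr
    have e3 : (1 + b)⁻¹ + (1 - b)⁻¹ = 2 / (1 - b ^ 2) := by
      have : 1 - b ^ 2 ≠ 0 := by nlinarith
      field_simp
      ring
    rw [e3, div_le_iff₀ (by linarith)]
    nlinarith [mul_nonneg (sq_nonneg (b ^ 2)) (by linarith : 0 ≤ 1 / 4 - b ^ 2), sq_nonneg (b ^ 2)]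
  · rw [hs]
    have hv0 : 0 < v := by linarith
    have hw0 : 0 < v - 1 := by linarith
    rw [← div_eq_inv_mul, div_le_iff₀ hv0, ← div_eq_inv_mul, le_div_iff₀ hw0, ← sub_nonneg]
    have : v - (1 + (1 * (4 * (v - 17) / v ^ 2) + 2 * (16 / v ^ 2)) / ((4 : ℕ) : ℝ)) * (v - 1) =
        (10 * v - 9) / v ^ 2 := by
      push_cast
      field_simp
      ring
    rw [this]
    have : 0 < 10 * v - 9 := by linarith
    positivity

theorem sum_three_le (r : ℕ) (hr : 1 ≤ r) :
    ∑ x ∈ lamF 3 r, (√(znorm x ^ 2 + 16))⁻¹ ≤ 27 * (r : ℝ) ^ 2 := by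
  have hr' : (1 : ℝ) ≤ r := by exact_mod_cast hr
  refine (sum_lamF_le _ (fun k => ((k : ℝ) + 1)⁻¹) (fun k x hx => ?_) r).trans ?_
  · have := natCast_succ_sq_le_znorm_sq hx
    gcongr
    exact Real.le_sqrt_of_sq_le (by linarith)
  · have h : ∀ k ∈ Finset.range r,
        ((2 * k + 3 : ℝ) ^ 3 - (2 * k + 1) ^ 3) * ((k : ℝ) + 1)⁻¹ ≤ 26 * r := by
      intro k hk
      have hk' : (k : ℝ) + 1 ≤ r := by exact_mod_cast Finset.mem_range.1 hk
      rw [← div_eq_mul_inv, div_le_iff₀ (by positivity)]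
      have : (0 : ℝ) ≤ k := by positivity
      nlinarith
    have h0 : (√(znorm (0 : Zd 3) ^ 2 + 16))⁻¹ ≤ 1 := by
      refine inv_le_one_of_one_le₀ (Real.one_le_sqrt.2 ?_)
      rw [znorm_zero]
      norm_num
    have := Finset.sum_le_card_nsmul _ _ _ h
    rw [Finset.card_range, nsmul_eq_mul] at this
    nlinarith

theorem sum_four_le (r : ℕ) (hr : 1 ≤ r) :
    ∑ x ∈ lamF 4 r, (znorm x ^ 2 + 16)⁻¹ ≤ 81 * (r : ℝ) ^ 2 := by
  have hr' : (1 : ℝ) ≤ r := by exact_mod_cast hr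
  refine (sum_lamF_le _ (fun k => (((k : ℝ) + 1) ^ 2)⁻¹) (fun k x hx => ?_) r).trans ?_
  · have := natCast_succ_sq_le_znorm_sq hx
    gcongr
    linarith
  · have h : ∀ k ∈ Finset.range r,
        ((2 * k + 3 : ℝ) ^ 4 - (2 * k + 1) ^ 4) * (((k : ℝ) + 1) ^ 2)⁻¹ ≤ 80 * r := by
      intro k hk
      have hk' : (k : ℝ) + 1 ≤ r := by exact_mod_cast Finset.mem_range.1 hk
      have h0 : (0 : ℝ) ≤ k := by positivity
      refine le_trans ?_ (mul_le_mul_of_nonneg_left hk' (by norm_num))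
      rw [← div_eq_mul_inv, div_le_iff₀ (by positivity)]
      nlinarith [mul_nonneg h0 h0, mul_nonneg (mul_nonneg h0 h0) h0]
    have h0 : (znorm (0 : Zd 4) ^ 2 + 16)⁻¹ ≤ 1 := by
      rw [znorm_zero]
      norm_num
    have := Finset.sum_le_card_nsmul _ _ _ h
    rw [Finset.card_range, nsmul_eq_mul] at this
    nlinarith

theorem sum_four_sq_le (n : ℕ) :
    ∑ x ∈ lamF 4 n, ((znorm x ^ 2 + 1)⁻¹) ^ 2 ≤ 81 * (1 + Real.log n) := by
  refine (sum_lamF_le _ (fun k => (((k : ℝ) + 1) ^ 4)⁻¹) (fun k x hx => ?_) n).trans ?_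
  · have := natCast_succ_sq_le_znorm_sq hx
    rw [inv_pow]
    have h2 : ((k : ℝ) + 1) ^ 4 = (((k : ℝ) + 1) ^ 2) ^ 2 := by ring
    rw [h2]
    gcongr
    linarith
  · have h : ∀ k ∈ Finset.range n,
        ((2 * k + 3 : ℝ) ^ 4 - (2 * k + 1) ^ 4) * (((k : ℝ) + 1) ^ 4)⁻¹ ≤
          80 * ((k : ℝ) + 1)⁻¹ := by
      intro k _
      have h0 : (0 : ℝ) ≤ k := by positivity
      rw [← div_eq_mul_inv, ← div_eq_mul_inv, div_le_div_iff₀ (by positivity) (by positivity)]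
      have h3 : (2 * k + 3 : ℝ) ^ 4 - (2 * k + 1) ^ 4 ≤ 80 * ((k : ℝ) + 1) ^ 3 := by
        nlinarith [mul_nonneg h0 h0, mul_nonneg (mul_nonneg h0 h0) h0]
      calc _ ≤ 80 * ((k : ℝ) + 1) ^ 3 * (k + 1) := by gcongr
        _ = _ := by ring
    have h1 := Finset.sum_le_sum h
    have h2 : ((harmonic n : ℚ) : ℝ) ≤ 1 + Real.log n := harmonic_le_one_add_log n
    rw [harmonic] at h2
    push_cast at h2
    rw [← Finset.mul_sum] at h1
    have h0 : ((znorm (0 : Zd 4) ^ 2 + 1)⁻¹) ^ 2 = 1 := by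
      rw [znorm_zero]
      norm_num
    rw [h0]
    have hlog : 0 ≤ Real.log n := Real.log_natCast_nonneg n
    linarith

theorem stmt8 (d : ℕ) (hd : d = 3 ∨ d = 4) (P : Measure (Zd d → ℝ))
    [IsProbabilityMeasure P]
    (hrange : ∀ᵐ ρ ∂P, ∀ x, ρ x ∈ Set.Ico (0 : ℝ) 1)
    (hstat : ∀ z : Zd d, P.map (fun ρ x => ρ (x + z)) = P)
    (hint : ∫⁻ ρ, piT ρ 0 ∂P < ∞) :
    ∃ R : ℝ, 0 < R ∧ ∃ c : ℝ, 0 < c ∧ ∃ K : ℕ, 1 ≤ K ∧ ∀ n : ℕ, 2 ≤ n →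
      (d = 3 → ENNReal.ofReal (c * n) ≤
        ∫⁻ ρ, ∑ x ∈ lamF d (K * n), piT ρ x * gKillTrap ρ R (K * n) 0 x ^ 2 ∂P) ∧
      (d = 4 → ENNReal.ofReal (c * Real.log n) ≤
        ∫⁻ ρ, ∑ x ∈ lamF d (K * n), piT ρ x * gKillTrap ρ R (K * n) 0 x ^ 2 ∂P) := by
  rcases hd with rfl | rfl
  · obtain ⟨R, hR, hmain⟩ := exists_annealed_bound (by norm_num) P hrange hstat hint
      (fun y : Zd 3 => (√(znorm y ^ 2 + 16))⁻¹) (fun x => by positivity) superharmonic_three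
      (by
        rw [nbrAvg_radial (fun u => (√(u + 16))⁻¹)]
        simp only [znorm_zero, Pi.zero_apply, Int.cast_zero, Fin.sum_univ_three]
        have h16 : √(16 : ℝ) < √17 := Real.sqrt_lt_sqrt (by norm_num) (by norm_num)
        have h : (√(17 : ℝ))⁻¹ < (√16)⁻¹ := inv_strictAnti₀ (by positivity) h16
        norm_num at h ⊢
        linarith)
      27 (by norm_num) sum_three_le
    refine ⟨R, hR, 1 / 54, by norm_num, 1, le_rfl, fun n hn => ⟨fun _ => ?_, by norm_num⟩⟩
    rw [one_mul]
    have hn' : (2 : ℝ) ≤ n := by exact_mod_cast hn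
    refine le_trans (le_of_eq ?_) (hmain n (fun x => znorm x ^ 2) (fun _ => 1) ((n : ℝ) ^ 2)
      (27 * (n : ℝ) ^ 3) (by simp [znorm_zero]) (fun x => sq_nonneg _) (sq_nonneg _)
      (fun x hx => ?_) (fun x => ?_) (by positivity) ?_)
    · congr 1
      field_simp
      norm_num
    · exact le_trans (by gcongr; linarith) (natCast_succ_sq_le_znorm_sq hx)
    · exact nbrAvg_radial_le_add (by norm_num) (fun u => u) x 1 fun u _ => by linarith
    · simp only [one_pow, Finset.sum_const, card_lamF, nsmul_eq_mul, mul_one]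
      push_cast
      calc (2 * (n : ℝ) + 1) ^ 3 ≤ (3 * n) ^ 3 := by gcongr; linarith
        _ = _ := by ring
  · obtain ⟨R, hR, hmain⟩ := exists_annealed_bound (by norm_num) P hrange hstat hint
      (fun y : Zd 4 => (znorm y ^ 2 + 16)⁻¹) (fun x => by positivity) superharmonic_four
      (by
        rw [nbrAvg_radial (fun u => (u + 16)⁻¹)]
        simp only [znorm_zero, Pi.zero_apply, Int.cast_zero, Fin.sum_univ_four]
        norm_num)
      81 (by norm_num) sum_four_le
    refine ⟨R, hR, 1 / 200, by norm_num, 1, le_rfl, fun n hn => ⟨by norm_num, fun _ => ?_⟩⟩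
    rw [one_mul]
    have hn' : (2 : ℝ) ≤ n := by exact_mod_cast hn
    have hlog : 1 / 2 ≤ Real.log n :=
      (by linarith [Real.log_two_gt_d9] : (1 / 2 : ℝ) ≤ Real.log 2).trans
        (Real.log_le_log (by norm_num) hn')
    refine le_trans (ENNReal.ofReal_le_ofReal ?_) (hmain n (fun x => Real.log (znorm x ^ 2 + 1))
      (fun x => (znorm x ^ 2 + 1)⁻¹) (2 * Real.log n) (81 * (1 + Real.log n))
      (by simp [znorm_zero]) (fun x => Real.log_nonneg (by linarith [sq_nonneg (znorm x)]))
      (by linarith) (fun x hx => ?_) (fun x => ?_) (by linarith) (sum_four_sq_le n))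
    · rw [div_div, le_div_iff₀ (by linarith)]
      nlinarith
    · have h1 := natCast_succ_sq_le_znorm_sq hx
      have h2 : 2 * Real.log n = Real.log ((n : ℝ) ^ 2) := by rw [Real.log_pow]; norm_num
      rw [h2]
      exact Real.log_le_log (by positivity) (by nlinarith)
    · refine nbrAvg_radial_le_add (by norm_num) (fun u => Real.log (u + 1)) x _ fun u hu => ?_
      have hs : 0 < znorm x ^ 2 + 1 := by positivity
      have hu' : 0 < u + 1 := by linarith
      have h1 := Real.log_le_sub_one_of_pos (div_pos hu' hs)
      rw [Real.log_div hu'.ne' hs.ne'] at h1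
      have h2 : (u + 1) / (znorm x ^ 2 + 1) - 1 = (znorm x ^ 2 + 1)⁻¹ * (u - znorm x ^ 2) := by
        field_simp
        ring
      linarith
end
end
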